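/- arXiv:1004.4267 — 2 statements merged into one kernel-verified Lean document; each statement's English description precedes it below -/
import Mathlib

section
/- Let n ≥ 1, μ > 0, α > 0, γ ≥ 0. Under Condition A, let B = P·diag(d₁,d₂)·P⁻¹ with P an invertible real 2×2 matrix, and set Q(t) := P·diag(e^{d₁t}, e^{d₂t})·P⁻¹. For j ∈ {1,2} let η_j be jointly measurable centered real random fields on ℝⁿ with unit variance, covariance E[η_j(x)η_j(x')] = R_j(x−x') = ∫_{ℝⁿ} e^{i⟨λ, x−x'⟩} F_j(dλ) for finite Borel measures F_j on ℝⁿ, and with η₁ and η₂ independent. For each t > 0 let G_t : ℝⁿ → ℝ be integrable with ∫_{ℝⁿ} e^{i⟨x,λ⟩} G_t(x) dx = exp(−μ t |λ|^α (1+|λ|²)^{γ/2}) for all λ ∈ ℝⁿ. Define w(t,x) := Q(t)·(U(t,x), V(t,x))ᵀ where U(t,x) = ∫_{ℝⁿ} G_t(y) η₁(x−y) dy and V(t,x) = ∫_{ℝⁿ} G_t(y) η₂(x−y) dy (these integrals converge absolutely almost surely). Then for all t, t' > 0 and x, x' ∈ ℝⁿ, the covariance matrix satisfies, for each i, j ∈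 {1,2}: E[w_i(t,x) w_j(t',x')] = Σ_{k=1}^{2} Q(t)_{ik} Q(t')_{jk} ∫_{ℝⁿ} e^{i⟨λ, x−x'⟩} e^{−μ(t+t')|λ|^α(1+|λ|²)^{γ/2}} F_k(dλ). -/
open MeasureTheory ProbabilityTheory Filter Topology
open scoped RealInnerProductSpace

section SecondMoments

variable {Ω : Type*} [MeasurableSpace Ω] {P : Measure Ω}

theorem integrable_sq_of_integral_sq_eq_one {X : Ω → ℝ} (h : ∫ ω, (X ω) ^ 2 ∂P = 1) :
    Integrable (fun ω => (X ω) ^ 2) P := by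
  by_contra hc
  rw [integral_undef hc] at h
  exact zero_ne_one h

theorem memLp_two_of_integral_sq_eq_one {X : Ω → ℝ} (hX : Measurable X)
    (h : ∫ ω, (X ω) ^ 2 ∂P = 1) : MemLp X 2 P :=
  (memLp_two_iff_integrable_sq hX.aestronglyMeasurable).2
    (integrable_sq_of_integral_sq_eq_one h)

theorem integral_abs_mul_le_one {X Y : Ω → ℝ} (hX : ∫ ω, (X ω) ^ 2 ∂P = 1)
    (hY : ∫ ω, (Y ω) ^ 2 ∂P = 1) : ∫ ω, |X ω * Y ω| ∂P ≤ 1 := by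
  have hX' := integrable_sq_of_integral_sq_eq_one hX
  have hY' := integrable_sq_of_integral_sq_eq_one hY
  calc ∫ ω, |X ω * Y ω| ∂P ≤ ∫ ω, ((X ω) ^ 2 + (Y ω) ^ 2) / 2 ∂P := by
        refine integral_mono_of_nonneg (.of_forall fun ω => abs_nonneg _)
          ((hX'.add hY').div_const 2) (.of_forall fun ω => ?_)
        simp only [abs_mul]
        nlinarith [sq_nonneg (|X ω| - |Y ω|), sq_abs (X ω), sq_abs (Y ω)]
    _ = 1 := by
        rw [integral_div, integral_add hX' hY', hX, hY]
        norm_num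

variable {E : Type*} [MeasurableSpace E] {ν : Measure E} [SFinite P]

/-- Weighted products of two unit-variance random fields are jointly integrable. -/
theorem integrable_weighted_mul {f g : E → ℝ} (hf : Integrable f ν) (hg : Integrable g ν)
    {ξ ζ : E → Ω → ℝ} (hξ : Measurable fun p : E × Ω => ξ p.1 p.2)
    (hζ : Measurable fun p : E × Ω => ζ p.1 p.2)
    (hξ2 : ∀ y, ∫ ω, (ξ y ω) ^ 2 ∂P = 1) (hζ2 : ∀ y, ∫ ω, (ζ y ω) ^ 2 ∂P = 1) :
    Integrable (fun p : (E × E) × Ω => f p.1.1 * g p.1.2 * (ξ p.1.1 p.2 * ζ p.1.2 p.2))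
      ((ν.prod ν).prod P) := by
  have hfg : Integrable (fun p : E × E => f p.1 * g p.2) (ν.prod ν) := hf.mul_prod hg
  have hm : AEStronglyMeasurable
      (fun p : (E × E) × Ω => f p.1.1 * g p.1.2 * (ξ p.1.1 p.2 * ζ p.1.2 p.2))
      ((ν.prod ν).prod P) := by
    refine hfg.aestronglyMeasurable.comp_fst.mul (Measurable.aestronglyMeasurable ?_)
    exact (hξ.comp (measurable_fst.fst.prodMk measurable_snd)).mul
      (hζ.comp (measurable_fst.snd.prodMk measurable_snd))
  refine (integrable_prod_iff hm).2 ⟨.of_forall fun p => ?_, ?_⟩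
  · exact ((memLp_two_of_integral_sq_eq_one hξ.of_uncurry_left (hξ2 p.1)).integrable_mul
      (memLp_two_of_integral_sq_eq_one hζ.of_uncurry_left (hζ2 p.2))).const_mul
        (f p.1 * g p.2)
  · refine hfg.norm.mono hm.norm.integral_prod_right' (.of_forall fun p => ?_)
    simp only [norm_mul (f p.1 * g p.2), integral_const_mul]
    rw [norm_mul, norm_norm]
    refine mul_le_of_le_one_right (norm_nonneg _) ?_
    rw [Real.norm_of_nonneg (integral_nonneg fun ω => norm_nonneg _)]
    exact integral_abs_mul_le_one (hξ2 p.1) (hζ2 p.2)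

variable [SFinite ν]

theorem integrable_integral_mul_integral {f g : E → ℝ} (hf : Integrable f ν)
    (hg : Integrable g ν)
    {ξ ζ : E → Ω → ℝ} (hξ : Measurable fun p : E × Ω => ξ p.1 p.2)
    (hζ : Measurable fun p : E × Ω => ζ p.1 p.2)
    (hξ2 : ∀ y, ∫ ω, (ξ y ω) ^ 2 ∂P = 1) (hζ2 : ∀ y, ∫ ω, (ζ y ω) ^ 2 ∂P = 1) :
    Integrable (fun ω => (∫ y, f y * ξ y ω ∂ν) * ∫ z, g z * ζ z ω ∂ν) P := by
  refine (integrable_weighted_mul hf hg hξ hζ hξ2 hζ2).integral_prod_right.congr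
    (.of_forall fun ω => ?_)
  simp only [← integral_prod_mul, mul_mul_mul_comm]

theorem integral_integral_mul_integral {f g : E → ℝ} (hf : Integrable f ν)
    (hg : Integrable g ν)
    {ξ ζ : E → Ω → ℝ} (hξ : Measurable fun p : E × Ω => ξ p.1 p.2)
    (hζ : Measurable fun p : E × Ω => ζ p.1 p.2)
    (hξ2 : ∀ y, ∫ ω, (ξ y ω) ^ 2 ∂P = 1) (hζ2 : ∀ y, ∫ ω, (ζ y ω) ^ 2 ∂P = 1) :
    ∫ ω, (∫ y, f y * ξ y ω ∂ν) * (∫ z, g z * ζ z ω ∂ν) ∂P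
      = ∫ p : E × E, f p.1 * g p.2 * ∫ ω, ξ p.1 ω * ζ p.2 ω ∂P ∂(ν.prod ν) := by
  simp only [← integral_const_mul (f _ * g _)]
  rw [integral_integral_swap (integrable_weighted_mul hf hg hξ hζ hξ2 hζ2)]
  simp only [← integral_prod_mul, mul_mul_mul_comm]

end SecondMoments

/-- Smoothing a stationary covariance with two integrable kernels multiplies its spectral measure
by the Fourier transforms of the kernels. -/
theorem integral_mul_fourier_measure {E : Type*} [NormedAddCommGroup E] [InnerProductSpace ℝ E]
    [MeasurableSpace E] [BorelSpace E] [SecondCountableTopology E] {ν F : Measure E} [SFinite ν]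
    [IsFiniteMeasure F] {f g : E → ℝ} (hf : Integrable f ν) (hg : Integrable g ν) (a : E) :
    ∫ p : E × E, (f p.1 : ℂ) * g p.2 *
        ∫ l, Complex.exp (Complex.I * ((⟪l, a - p.1 + p.2⟫ : ℝ) : ℂ)) ∂F ∂(ν.prod ν)
      = ∫ l, Complex.exp (Complex.I * ((⟪l, a⟫ : ℝ) : ℂ)) *
          ((∫ y, Complex.exp (Complex.I * ((⟪y, -l⟫ : ℝ) : ℂ)) * f y ∂ν) *
            ∫ z, Complex.exp (Complex.I * ((⟪z, l⟫ : ℝ) : ℂ)) * g z ∂ν) ∂F := by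
  have hfg : Integrable (fun p : E × E => (f p.1 : ℂ) * g p.2) (ν.prod ν) :=
    hf.ofReal.mul_prod hg.ofReal
  have hint : Integrable (fun q : (E × E) × E => (f q.1.1 : ℂ) * g q.1.2 *
      Complex.exp (Complex.I * ((⟪q.2, a - q.1.1 + q.1.2⟫ : ℝ) : ℂ))) ((ν.prod ν).prod F) := by
    refine (hfg.comp_fst F).mul_bdd (c := 1) ?_ (.of_forall fun q => ?_)
    · exact (by fun_prop : Measurable fun q : (E × E) × E =>
        Complex.exp (Complex.I * ((⟪q.2, a - q.1.1 + q.1.2⟫ : ℝ) : ℂ))).aestronglyMeasurable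
    · rw [Complex.norm_exp_I_mul_ofReal]
  simp only [← integral_const_mul ((f _ : ℂ) * g _)]
  rw [integral_integral_swap hint]
  refine integral_congr_ae (.of_forall fun l => ?_)
  simp only [← integral_prod_mul]
  rw [← integral_const_mul]
  refine integral_congr_ae (.of_forall fun p => ?_)
  have hexp : Complex.exp (Complex.I * ((⟪l, a - p.1 + p.2⟫ : ℝ) : ℂ))
      = Complex.exp (Complex.I * ((⟪l, a⟫ : ℝ) : ℂ)) *
        Complex.exp (Complex.I * ((⟪p.1, -l⟫ : ℝ) : ℂ)) *
          Complex.exp (Complex.I * ((⟪p.2, l⟫ : ℝ) : ℂ)) := by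
    rw [← Complex.exp_add, ← Complex.exp_add, inner_add_right, inner_sub_right, inner_neg_right,
      real_inner_comm p.1 l, real_inner_comm p.2 l]
    congr 1
    push_cast
    ring
  simp only [hexp]
  ring

/-- Proposition 1 of the paper: the inter-relative covariance structure (3.6) of
the solution vector field `w(t,x) = Q(t)·(U,V)ᵀ(t,x)` of the fractional kinetic
system with independent homogeneous random initial data with spectral measures
`F₁, F₂`. -/
theorem covariance_structure_of_system
    (n : ℕ) (hn : 1 ≤ n) (μ α γ : ℝ) (hμ : 0 < μ) (hα : 0 < α) (hγ : 0 ≤ γ)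
    {Ω : Type*} [MeasurableSpace Ω] {P : Measure Ω} [IsProbabilityMeasure P]
    (Pm : Matrix (Fin 2) (Fin 2) ℝ) (hPm : IsUnit Pm.det) (d : Fin 2 → ℝ)
    (Q : ℝ → Matrix (Fin 2) (Fin 2) ℝ)
    (hQ : ∀ t, Q t = Pm * Matrix.diagonal (fun j => Real.exp (d j * t)) * Pm⁻¹)
    (η : Fin 2 → EuclideanSpace ℝ (Fin n) → Ω → ℝ)
    (hηmeas : ∀ j, Measurable (fun pr : EuclideanSpace ℝ (Fin n) × Ω => η j pr.1 pr.2))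
    (hηmean : ∀ j x, ∫ ω, η j x ω ∂P = 0)
    (hηvar : ∀ j x, ∫ ω, (η j x ω) ^ 2 ∂P = 1)
    (F : Fin 2 → Measure (EuclideanSpace ℝ (Fin n)))
    (hF : ∀ j, IsFiniteMeasure (F j))
    (hηcov : ∀ j (x x' : EuclideanSpace ℝ (Fin n)),
      (↑(∫ ω, η j x ω * η j x' ω ∂P) : ℂ)
        = ∫ l, Complex.exp (Complex.I * ((⟪l, x - x'⟫ : ℝ) : ℂ)) ∂(F j))
    (hindep : IndepFun (fun ω x => η 0 x ω) (fun ω x => η 1 x ω) P)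
    (G : ℝ → EuclideanSpace ℝ (Fin n) → ℝ)
    (hGint : ∀ t > 0, Integrable (G t))
    (hGft : ∀ t > 0, ∀ l : EuclideanSpace ℝ (Fin n),
      ∫ x, Complex.exp (Complex.I * ((⟪x, l⟫ : ℝ) : ℂ)) * ↑(G t x)
        = ↑(Real.exp (-(μ * t * ‖l‖ ^ α * (1 + ‖l‖ ^ 2) ^ (γ / 2)))))
    (W : Fin 2 → ℝ → EuclideanSpace ℝ (Fin n) → Ω → ℝ)
    (hW : ∀ j t x ω, W j t x ω = ∫ y, G t y * η j (x - y) ω)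
    (hWas : ∀ j (t : ℝ), 0 < t → ∀ x, ∀ᵐ ω ∂P,
      Integrable (fun y => G t y * η j (x - y) ω))
    (w : ℝ → EuclideanSpace ℝ (Fin n) → Ω → Fin 2 → ℝ)
    (hw : ∀ t x ω i, w t x ω i = ∑ k, Q t i k * W k t x ω) :
    ∀ t t' : ℝ, 0 < t → 0 < t' → ∀ x x' : EuclideanSpace ℝ (Fin n), ∀ i j : Fin 2,
      (↑(∫ ω, w t x ω i * w t' x' ω j ∂P) : ℂ)
        = ∑ k, (↑(Q t i k) : ℂ) * ↑(Q t' j k) *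
            ∫ l, Complex.exp (Complex.I * ((⟪l, x - x'⟫ : ℝ) : ℂ)) *
              ↑(Real.exp (-(μ * (t + t') * ‖l‖ ^ α * (1 + ‖l‖ ^ 2) ^ (γ / 2)))) ∂(F k) := by
  intro t t' ht ht' x x' i j
  have hmeas : ∀ k (a : EuclideanSpace ℝ (Fin n)),
      Measurable fun p : EuclideanSpace ℝ (Fin n) × Ω => η k (a - p.1) p.2 := fun k a =>
    (hηmeas k).comp ((measurable_const.sub measurable_fst).prodMk measurable_snd)
  have hint : ∀ k m, Integrable (fun ω => W k t x ω * W m t' x' ω) P := fun k m => by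
    simp only [hW]
    exact integrable_integral_mul_integral (hGint t ht) (hGint t' ht') (hmeas k x) (hmeas m x')
      (fun y => hηvar k _) (fun y => hηvar m _)
  have hmoment : ∀ k m, ∫ ω, W k t x ω * W m t' x' ω ∂P
      = ∫ p : EuclideanSpace ℝ (Fin n) × EuclideanSpace ℝ (Fin n),
          G t p.1 * G t' p.2 * ∫ ω, η k (x - p.1) ω * η m (x' - p.2) ω ∂P := fun k m => by
    simp only [hW]
    exact integral_integral_mul_integral (hGint t ht) (hGint t' ht') (hmeas k x) (hmeas m x')
      (fun y => hηvar k _) (fun y => hηvar m _)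
  have huncorr : ∀ y z, ∫ ω, η 0 y ω * η 1 z ω ∂P = 0 := fun y z => by
    have h : IndepFun (η 0 y) (η 1 z) P :=
      hindep.comp (measurable_pi_apply y) (measurable_pi_apply z)
    rw [h.integral_fun_mul_eq_mul_integral (hηmeas 0).of_uncurry_left.aestronglyMeasurable
      (hηmeas 1).of_uncurry_left.aestronglyMeasurable, hηmean, zero_mul]
  have hcross : ∀ k m, k ≠ m → ∫ ω, W k t x ω * W m t' x' ω ∂P = 0 := fun k m hkm => by
    have h : ∀ y z, ∫ ω, η k y ω * η m z ω ∂P = 0 := fun y z => by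
      fin_cases k <;> fin_cases m
      · exact absurd rfl hkm
      · exact huncorr y z
      · exact (integral_congr_ae (.of_forall fun ω => mul_comm _ _)).trans (huncorr z y)
      · exact absurd rfl hkm
    simp only [hmoment, h, mul_zero, integral_zero]
  have hdiag : ∀ k, ((∫ ω, W k t x ω * W k t' x' ω ∂P : ℝ) : ℂ)
      = ∫ l, Complex.exp (Complex.I * ((⟪l, x - x'⟫ : ℝ) : ℂ)) *
          ↑(Real.exp (-(μ * (t + t') * ‖l‖ ^ α * (1 + ‖l‖ ^ 2) ^ (γ / 2)))) ∂(F k) := fun k => by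
    have := hF k
    have hshift : ∀ y z, x - y - (x' - z) = x - x' - y + z := fun y z => by abel
    rw [hmoment, ← integral_complex_ofReal]
    simp only [Complex.ofReal_mul, hηcov, hshift]
    rw [Measure.volume_eq_prod, integral_mul_fourier_measure (hGint t ht) (hGint t' ht')]
    simp only [hGft t ht, hGft t' ht', norm_neg, ← Complex.ofReal_mul, ← Real.exp_add]
    refine integral_congr_ae (.of_forall fun l => ?_)
    ring_nf
  have hsum : ∫ ω, w t x ω i * w t' x' ω j ∂P
      = ∑ k, Q t i k * Q t' j k * ∫ ω, W k t x ω * W k t' x' ω ∂P := by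
    have hexpand : ∀ ω, w t x ω i * w t' x' ω j
        = ∑ k, ∑ m, Q t i k * Q t' j m * (W k t x ω * W m t' x' ω) := fun ω => by
      simp only [hw, Finset.sum_mul_sum, mul_mul_mul_comm]
    simp only [hexpand]
    rw [integral_finsetSum _ fun k _ => integrable_finsetSum _ fun m _ => (hint k m).const_mul _]
    refine Finset.sum_congr rfl fun k _ => ?_
    rw [integral_finsetSum _ fun m _ => (hint k m).const_mul _]
    simp only [integral_const_mul]
    refine Finset.sum_eq_single k (fun m _ hmk => ?_) (fun h => absurd (Finset.mem_univ k) h)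
    rw [hcross k m hmk.symm, mul_zero]
  rw [hsum]
  simp only [Complex.ofReal_sum, Complex.ofReal_mul, hdiag]
end

section
/- Let n ≥ 1, μ > 0, α > 0, γ ≥ 0, χ > 0. On a probability space let ζ : ℝⁿ × Ω → ℝ be a jointly measurable random field such that every finite family (ζ(x₁),…,ζ(x_k)) is centered jointly Gaussian with E[ζ(x)²] = 1 and E[ζ(x)ζ(y)] = R(x−y), where R(z) = ∫_{ℝⁿ} e^{i⟨λ,z⟩} f(λ) dλ for a nonnegative integrable radial spectral density f that is decreasing in |λ| for |λ| > λ₀ (some λ₀ > 0) and continuous at every λ ≠ 0. Let h : ℝ → ℝ be Borel with ∫_ℝ h² dγ₁ < ∞ (γ₁ the standard Gaussian measure), Hermite coefficients C_σ(h) = ∫_ℝ h(u)(H_σ(u)/√(σ!)) γ₁(du), and Hermite rank m := inf{σ ≥ 1 : C_σ(h) ≠ 0}. Assume R(x) ∼ L(|x|)/|x|^κ as |x| → ∞, where 0 < κ < n/m and L : (0,∞) → (0,∞) is slowly varying at infinity and bounded on each finite interval. For each s > 0 let G_s : ℝⁿ → ℝ be integrable with ∫ e^{i⟨y,λ⟩}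 G_s(y) dy = exp(−μ s |λ|^α(1+|λ|²)^{γ/2}). Define s^ε(t,x) := (ε^{mκχ} L^m(ε^{−χ}))^{−1/2} ( ∫_{ℝⁿ} G_{εt}(y) h(ζ(ε^{−1/(α+γ)−χ}(ε^{1/(α+γ)} x − y))) dy − C₀(h) ). Then for all t, t' > 0 and x, x' ∈ ℝⁿ: lim_{ε→0⁺} Cov(s^ε(t,x), s^ε(t',x')) = C_m(h)²·K(n,mκ)·∫_{ℝⁿ} e^{i⟨x−x',τ⟩} e^{−μ(t+t')|τ|^{α+γ}} |τ|^{mκ−n} dτ, where K(n,a) := Γ((n−a)/2)/(2^a π^{n/2} Γ(a/2)). -/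
open MeasureTheory ProbabilityTheory Filter Topology
open scoped RealInnerProductSpace

/-- The probabilists' Hermite polynomial of degree `σ`, as a real function. -/
noncomputable def hermiteFun (σ : ℕ) (u : ℝ) : ℝ :=
  Polynomial.aeval u (Polynomial.hermite σ)

/-- The Tauberian constant `K(n,c) = Γ((n−c)/2)/(2^c π^{n/2} Γ(c/2))`. -/
noncomputable def tauberK (n : ℕ) (c : ℝ) : ℝ :=
  Real.Gamma (((n : ℝ) - c) / 2) /
    ((2 : ℝ) ^ c * Real.pi ^ ((n : ℝ) / 2) * Real.Gamma (c / 2))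

/-- `L` is slowly varying at infinity: `L(cy)/L(y) → 1` as `y → ∞`, uniformly
for `c` in compact subintervals of `(0,∞)`. -/
def SlowlyVaryingAtTop (L : ℝ → ℝ) : Prop :=
  ∀ a b : ℝ, 0 < a → a < b →
    TendstoUniformlyOn (fun y c => L (c * y) / L y) (fun _ => 1) atTop (Set.Icc a b)

/-! ### Hermite polynomials and the Gaussian measure -/

/-- The Hermite polynomial with real coefficients. -/
noncomputable def realHermite (σ : ℕ) : Polynomial ℝ :=
  (Polynomial.hermite σ).map (Int.castRingHom ℝ)

lemma hermiteFun_eq_eval (σ : ℕ) (u : ℝ) : hermiteFun σ u = (realHermite σ).eval u := by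
  rw [hermiteFun, realHermite, Polynomial.eval_map, Polynomial.aeval_def]
  rfl

lemma realHermite_zero : realHermite 0 = 1 := by simp [realHermite]

lemma realHermite_succ (σ : ℕ) :
    realHermite (σ + 1) =
      Polynomial.X * realHermite σ - Polynomial.derivative (realHermite σ) := by
  simp [realHermite, Polynomial.hermite_succ, Polynomial.derivative_map]

lemma derivative_realHermite_succ (σ : ℕ) :
    Polynomial.derivative (realHermite (σ + 1)) = ((σ : ℝ) + 1) • realHermite σ := by
  induction σ with
  | zero => simp [realHermite_succ, realHermite_zero]
  | succ k ih =>
    rw [realHermite_succ (k + 1), Polynomial.derivative_sub, Polynomial.derivative_mul, ih,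
      Polynomial.derivative_X, Polynomial.derivative_smul]
    conv_rhs => rw [realHermite_succ k]
    rw [realHermite_succ k]
    push_cast
    simp only [Polynomial.smul_eq_C_mul, map_add, map_one]
    ring

lemma integrable_gaussian_iff {w : ℝ → ℝ} :
    Integrable w (gaussianReal 0 1) ↔ Integrable (fun x => gaussianPDFReal 0 1 x * w x) := by
  rw [gaussianReal_of_var_ne_zero _ one_ne_zero,
    integrable_withDensity_iff_integrable_smul' (measurable_gaussianPDF _ _)
      (ae_of_all _ fun _ => gaussianPDF_lt_top)]
  simp [toReal_gaussianPDF]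

/-- Gaussian integration by parts. -/
lemma integral_deriv_sub_mul_gaussian {w w' : ℝ → ℝ} (hw : ∀ x, HasDerivAt w (w' x) x)
    (hint : Integrable w (gaussianReal 0 1))
    (hint' : Integrable (fun x => w' x - x * w x) (gaussianReal 0 1)) :
    ∫ x, (w' x - x * w x) ∂(gaussianReal 0 1) = 0 := by
  rw [integral_gaussianReal_eq_integral_smul one_ne_zero]
  rw [integrable_gaussian_iff] at hint hint'
  refine integral_eq_zero_of_hasDerivAt_of_integrable (f := fun x => gaussianPDFReal 0 1 x * w x)
    (fun x => ?_) hint' hint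
  have h1 : HasDerivAt (fun x => gaussianPDFReal 0 1 x) (-x * gaussianPDFReal 0 1 x) x := by
    rw [gaussianPDFReal_def]
    have : HasDerivAt (fun x : ℝ => -(x - 0) ^ 2 / (2 * ((1 : NNReal) : ℝ))) (-x) x := by
      have := (((hasDerivAt_id x).sub_const 0).pow 2).neg.div_const (2 * ((1 : NNReal) : ℝ))
      refine this.congr_deriv ?_
      simp
      ring
    refine HasDerivAt.congr_deriv (this.exp.const_mul (√(2 * Real.pi * ((1 : NNReal) : ℝ)))⁻¹) ?_
    ring
  refine (h1.mul (hw x)).congr_deriv ?_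
  ring

lemma integrable_polynomial_mul_exp_gaussian (p : Polynomial ℝ) (c : ℝ) :
    Integrable (fun x => p.eval x * Real.exp (c * x)) (gaussianReal 0 1) := by
  induction p using Polynomial.induction_on' with
  | add p q hp hq =>
    simp only [Polynomial.eval_add, add_mul]
    exact hp.add hq
  | monomial k a =>
    have := integrable_pow_mul_exp_of_mem_interior_integrableExpSet (X := id)
      (μ := gaussianReal 0 1) (v := c) (by simp) k
    simpa [mul_assoc] using this.const_mul a

lemma integrable_polynomial_gaussian (p : Polynomial ℝ) :
    Integrable (fun x => p.eval x) (gaussianReal 0 1) := by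
  simpa using integrable_polynomial_mul_exp_gaussian p 0

lemma integral_exp_mul_realHermite (c : ℝ) (σ : ℕ) :
    ∫ x, (realHermite σ).eval x * Real.exp (c * x) ∂(gaussianReal 0 1)
      = c ^ σ * Real.exp (c ^ 2 / 2) := by
  induction σ with
  | zero =>
    have := congrFun (mgf_id_gaussianReal (μ := 0) (v := 1)) c
    simpa [realHermite_zero, mgf] using this
  | succ k ih =>
    have h := integral_deriv_sub_mul_gaussian
      (w := fun x => (realHermite k).eval x * Real.exp (c * x))
      (w' := fun x => (Polynomial.derivative (realHermite k)).eval x * Real.exp (c * x)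
        + (realHermite k).eval x * (Real.exp (c * x) * c))
      (fun x => ((realHermite k).hasDerivAt x).mul
        (by simpa using ((hasDerivAt_id x).const_mul c).exp))
      (integrable_polynomial_mul_exp_gaussian _ c)
    have e : ∀ x, (Polynomial.derivative (realHermite k)).eval x * Real.exp (c * x)
        + (realHermite k).eval x * (Real.exp (c * x) * c)
        - x * ((realHermite k).eval x * Real.exp (c * x))
        = c * ((realHermite k).eval x * Real.exp (c * x))
          - (realHermite (k + 1)).eval x * Real.exp (c * x) := by
      intro x
      rw [realHermite_succ]
      simp only [Polynomial.eval_sub, Polynomial.eval_mul, Polynomial.eval_X]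
      ring
    simp only [e] at h
    have i1 := (integrable_polynomial_mul_exp_gaussian (realHermite k) c).const_mul c
    have i2 := integrable_polynomial_mul_exp_gaussian (realHermite (k + 1)) c
    have h2 := h (i1.sub i2)
    rw [integral_sub i1 i2, integral_const_mul, ih] at h2
    rw [pow_succ]
    linarith

lemma integral_mul_realHermite_succ (q : Polynomial ℝ) (k : ℕ) :
    ∫ x, q.eval x * (realHermite (k + 1)).eval x ∂(gaussianReal 0 1)
      = ∫ x, (Polynomial.derivative q).eval x * (realHermite k).eval x ∂(gaussianReal 0 1) := by
  have h := integral_deriv_sub_mul_gaussian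
      (w := fun x => (q * realHermite k).eval x)
      (w' := fun x => (Polynomial.derivative (q * realHermite k)).eval x)
      (fun x => (q * realHermite k).hasDerivAt x) (integrable_polynomial_gaussian _)
  have e : ∀ x, (Polynomial.derivative (q * realHermite k)).eval x
      - x * (q * realHermite k).eval x
      = (Polynomial.derivative q * realHermite k).eval x
        - (q * realHermite (k + 1)).eval x := by
    intro x
    rw [realHermite_succ]
    simp only [Polynomial.eval_sub, Polynomial.eval_mul, Polynomial.eval_X,
      Polynomial.derivative_mul, Polynomial.eval_add]
    ring
  simp only [e] at h
  have i1 := integrable_polynomial_gaussian (Polynomial.derivative q * realHermite k)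
  have i2 := integrable_polynomial_gaussian (q * realHermite (k + 1))
  have h2 := h (i1.sub i2)
  rw [integral_sub i1 i2] at h2
  simp only [Polynomial.eval_mul] at h2
  linarith

lemma integral_realHermite_mul (j k : ℕ) :
    ∫ x, (realHermite j).eval x * (realHermite k).eval x ∂(gaussianReal 0 1)
      = if j = k then (j.factorial : ℝ) else 0 := by
  induction k generalizing j with
  | zero =>
    cases j with
    | zero => simp [realHermite_zero]
    | succ j =>
      simp_rw [mul_comm ((realHermite (j + 1)).eval _)]
      rw [integral_mul_realHermite_succ]
      simp [realHermite_zero]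
  | succ k ih =>
    rw [integral_mul_realHermite_succ]
    cases j with
    | zero => simp [realHermite_zero]
    | succ j =>
      simp only [derivative_realHermite_succ, Polynomial.eval_smul, smul_eq_mul, mul_assoc,
        integral_const_mul, ih]
      split_ifs <;> simp_all [Nat.factorial_succ]

/-! ### Mehler's formula -/

lemma memLp_polynomial_gaussian (p : Polynomial ℝ) :
    MemLp (fun x => p.eval x) 2 (gaussianReal 0 1) := by
  rw [memLp_two_iff_integrable_sq (by fun_prop)]
  exact (integrable_polynomial_gaussian (p ^ 2)).congr (ae_of_all _ fun x => by simp)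

lemma memLp_exp_gaussian (c : ℝ) :
    MemLp (fun x => Real.exp (c * x)) 2 (gaussianReal 0 1) := by
  rw [memLp_two_iff_integrable_sq (by fun_prop)]
  have := integrable_polynomial_mul_exp_gaussian 1 (2 * c)
  simp only [Polynomial.eval_one, one_mul] at this
  refine this.congr (ae_of_all _ fun x => ?_)
  simp only [← Real.exp_nat_mul]
  push_cast
  ring_nf

/-- The normalized Hermite functions, as elements of `L²` of the Gaussian measure. -/
noncomputable def hermiteLp (σ : ℕ) : Lp ℝ 2 (gaussianReal 0 1) :=
  (Real.sqrt σ.factorial)⁻¹ • (memLp_polynomial_gaussian (realHermite σ)).toLp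

/-- The exponentials, as elements of `L²` of the Gaussian measure. -/
noncomputable def expLp (c : ℝ) : Lp ℝ 2 (gaussianReal 0 1) := (memLp_exp_gaussian c).toLp

lemma inner_toLp {Ω : Type*} [MeasurableSpace Ω] {P : Measure Ω} {g h : Ω → ℝ} (hg : MemLp g 2 P)
    (hh : MemLp h 2 P) : ⟪hg.toLp, hh.toLp⟫ = ∫ x, g x * h x ∂P := by
  rw [L2.inner_def]
  refine integral_congr_ae ?_
  filter_upwards [hg.coeFn_toLp, hh.coeFn_toLp] with x h1 h2
  rw [h1, h2]
  simp [mul_comm]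

lemma inner_hermiteLp_toLp (σ : ℕ) {h : ℝ → ℝ} (hh : MemLp h 2 (gaussianReal 0 1)) :
    ⟪hermiteLp σ, hh.toLp⟫
      = ∫ u, h u * (hermiteFun σ u / Real.sqrt σ.factorial) ∂(gaussianReal 0 1) := by
  rw [hermiteLp, real_inner_smul_left, inner_toLp, ← integral_const_mul]
  refine integral_congr_ae (ae_of_all _ fun x => ?_)
  simp only [hermiteFun_eq_eval]
  ring

lemma orthonormal_hermiteLp : Orthonormal ℝ hermiteLp := by
  rw [orthonormal_iff_ite]
  intro j k
  rw [hermiteLp, hermiteLp, real_inner_smul_left, real_inner_smul_right, inner_toLp,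
    integral_realHermite_mul]
  split_ifs with h
  · subst h
    have : (0 : ℝ) < j.factorial := by positivity
    have h2 := Real.mul_self_sqrt this.le
    have h3 := (Real.sqrt_pos.2 this).ne'
    field_simp
    nlinarith
  · simp

lemma inner_hermiteLp_expLp (σ : ℕ) (c : ℝ) :
    ⟪hermiteLp σ, expLp c⟫ = c ^ σ * Real.exp (c ^ 2 / 2) / Real.sqrt σ.factorial := by
  rw [hermiteLp, expLp, real_inner_smul_left, inner_toLp, integral_exp_mul_realHermite]
  ring

lemma ae_eq_zero_of_integral_mul_exp_eq_zero {g : ℝ → ℝ} (hg : MemLp g 2 (gaussianReal 0 1))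
    (h0 : ∀ c : ℝ, ∫ x, g x * Real.exp (c * x) ∂(gaussianReal 0 1) = 0) :
    g =ᵐ[gaussianReal 0 1] 0 := by
  set γ := gaussianReal 0 1
  have hgi : Integrable g γ := hg.integrable (by norm_num)
  let μp := γ.withDensity fun x => ENNReal.ofReal (g x)
  let μn := γ.withDensity fun x => ENNReal.ofReal (-g x)
  have hmp : AEMeasurable (fun x => ENNReal.ofReal (g x)) γ := hgi.1.aemeasurable.ennreal_ofReal
  have hmn : AEMeasurable (fun x => ENNReal.ofReal (-g x)) γ :=
    hgi.1.aemeasurable.neg.ennreal_ofReal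
  have : IsFiniteMeasure μp := isFiniteMeasure_withDensity_ofReal hgi.2
  have : IsFiniteMeasure μn := isFiniteMeasure_withDensity_ofReal hgi.neg.2
  have hge (c : ℝ) : Integrable (fun x => g x * Real.exp (c * x)) γ :=
    hg.integrable_mul (memLp_exp_gaussian c)
  have hp (c : ℝ) : Integrable (fun x => max (g x) 0 * Real.exp (c * x)) γ := by
    refine (hge c).mono (by
      exact ((hgi.1.aemeasurable.max aemeasurable_const).mul
        (by fun_prop)).aestronglyMeasurable) (ae_of_all _ fun x => ?_)
    rw [norm_mul, norm_mul]
    gcongr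
    simp only [Real.norm_eq_abs]
    rw [abs_of_nonneg (le_max_right _ _)]
    exact max_le (le_abs_self _) (abs_nonneg _)
  have hn (c : ℝ) : Integrable (fun x => max (-g x) 0 * Real.exp (c * x)) γ := by
    refine (hge c).mono (by
      exact ((hgi.1.aemeasurable.neg.max aemeasurable_const).mul
        (by fun_prop)).aestronglyMeasurable) (ae_of_all _ fun x => ?_)
    rw [norm_mul, norm_mul]
    gcongr
    simp only [Real.norm_eq_abs]
    rw [abs_of_nonneg (le_max_right _ _)]
    exact max_le (neg_le_abs _) (abs_nonneg _)
  have hmgf : mgf id μp = mgf id μn := by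
    funext c
    simp only [mgf, id, μp, μn]
    rw [integral_withDensity_eq_integral_toReal_smul₀ hmp (ae_of_all _ fun _ => by simp),
      integral_withDensity_eq_integral_toReal_smul₀ hmn (ae_of_all _ fun _ => by simp)]
    simp only [ENNReal.toReal_ofReal', smul_eq_mul]
    rw [← sub_eq_zero, ← integral_sub (hp c) (hn c)]
    refine Eq.trans ?_ (h0 c)
    refine integral_congr_ae (ae_of_all _ fun x => ?_)
    simp only
    rw [← sub_mul, max_zero_sub_eq_self]
  have hmass : μp = 0 ↔ μn = 0 := by
    have := congrFun hmgf 0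
    simp only [mgf, zero_mul, Real.exp_zero, integral_const, smul_eq_mul, mul_one] at this
    rw [← Measure.measure_univ_eq_zero, ← Measure.measure_univ_eq_zero,
      ← measureReal_eq_zero_iff, ← measureReal_eq_zero_iff, this]
  have hset : integrableExpSet id μp = Set.univ := by
    ext c
    simp only [integrableExpSet, Set.mem_ofPred_eq, Set.mem_univ, iff_true, id, μp]
    rw [integrable_withDensity_iff_integrable_smul₀' hmp (ae_of_all _ fun _ => by simp)]
    simpa only [ENNReal.toReal_ofReal', smul_eq_mul] using hp c
  have heq : μp = μn := by
    refine Measure.ext_of_complexMGF_id_eq ?_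
    funext z
    exact eqOn_complexMGF_of_mgf' hmgf hmass (by simp [hset])
  have h2 := withDensity_eq_iff hmp hmn
    ((lintegral_ofReal_le_lintegral_enorm g).trans_lt hgi.2).ne |>.1 heq
  filter_upwards [h2] with x hx
  have hx' := congrArg ENNReal.toReal hx
  simp only [ENNReal.toReal_ofReal'] at hx'
  have := max_zero_sub_eq_self (g x)
  rw [hx', sub_self] at this
  exact this.symm

lemma dense_span_expLp :
    Dense ((Submodule.span ℝ (Set.range expLp) : Submodule ℝ (Lp ℝ 2 (gaussianReal 0 1))) :
      Set (Lp ℝ 2 (gaussianReal 0 1))) := by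
  rw [Submodule.dense_iff_topologicalClosure_eq_top, Submodule.topologicalClosure_eq_top_iff,
    Submodule.eq_bot_iff]
  intro g hg
  rw [Submodule.mem_orthogonal'] at hg
  rw [Lp.eq_zero_iff_ae_eq_zero]
  refine ae_eq_zero_of_integral_mul_exp_eq_zero (Lp.memLp g) fun c => ?_
  have := hg (expLp c) (Submodule.subset_span ⟨c, rfl⟩)
  rw [← Lp.toLp_coeFn g (Lp.memLp g), expLp, inner_toLp] at this
  exact this

section MehlerForm

variable {H : Type*} [NormedAddCommGroup H] [InnerProductSpace ℝ H] {v : ℕ → H}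

lemma abs_sum_le_norm_mul_norm {r : ℝ} (hr : |r| ≤ 1) (hv : Orthonormal ℝ v) (g h : H)
    (s : Finset ℕ) :
    ∑ σ ∈ s, |r ^ σ * ⟪v σ, g⟫ * ⟪v σ, h⟫| ≤ ‖g‖ * ‖h‖ := by
  have hle : ∑ σ ∈ s, |r ^ σ * ⟪v σ, g⟫ * ⟪v σ, h⟫|
      ≤ ∑ σ ∈ s, |⟪v σ, g⟫| * |⟪v σ, h⟫| := by
    refine Finset.sum_le_sum fun σ _ => ?_
    rw [abs_mul, abs_mul, abs_pow]
    have : |r| ^ σ ≤ 1 := pow_le_one₀ (abs_nonneg r) hr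
    gcongr
    exact mul_le_of_le_one_left (abs_nonneg _) this
  refine hle.trans (abs_le_of_sq_le_sq' ?_ (by positivity)).2
  refine (Finset.sum_mul_sq_le_sq_mul_sq _ _ _).trans ?_
  rw [mul_pow]
  have h1 := hv.sum_inner_products_le g (s := s)
  have h2 := hv.sum_inner_products_le h (s := s)
  simp only [Real.norm_eq_abs] at h1 h2
  gcongr

lemma summable_mehler {r : ℝ} (hr : |r| ≤ 1) (hv : Orthonormal ℝ v) (g h : H) :
    Summable fun σ => r ^ σ * ⟪v σ, g⟫ * ⟪v σ, h⟫ :=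
  (summable_of_sum_le (fun _ => abs_nonneg _) (abs_sum_le_norm_mul_norm hr hv g h)).of_abs

/-- The Mehler form `∑ r^σ C_σ(g) C_σ(h)` as a bilinear form. -/
noncomputable def mehlerBilin {r : ℝ} (hr : |r| ≤ 1) (hv : Orthonormal ℝ v) :
    H →ₗ[ℝ] H →ₗ[ℝ] ℝ :=
  LinearMap.mk₂ ℝ (fun g h => ∑' σ, r ^ σ * ⟪v σ, g⟫ * ⟪v σ, h⟫)
    (fun g g' h => by
      rw [← (summable_mehler hr hv g h).tsum_add (summable_mehler hr hv g' h)]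
      refine tsum_congr fun σ => ?_
      rw [inner_add_right]
      ring)
    (fun c g h => by
      rw [smul_eq_mul, ← tsum_mul_left]
      refine tsum_congr fun σ => ?_
      rw [real_inner_smul_right]
      ring)
    (fun g h h' => by
      rw [← (summable_mehler hr hv g h).tsum_add (summable_mehler hr hv g h')]
      refine tsum_congr fun σ => ?_
      rw [inner_add_right]
      ring)
    (fun c g h => by
      rw [smul_eq_mul, ← tsum_mul_left]
      refine tsum_congr fun σ => ?_
      rw [real_inner_smul_right]
      ring)

lemma norm_mehlerBilin_le {r : ℝ} (hr : |r| ≤ 1) (hv : Orthonormal ℝ v) (g h : H) :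
    ‖mehlerBilin hr hv g h‖ ≤ 1 * ‖g‖ * ‖h‖ := by
  change ‖∑' σ, r ^ σ * ⟪v σ, g⟫ * ⟪v σ, h⟫‖ ≤ _
  have h1 : Summable fun σ => ‖r ^ σ * ⟪v σ, g⟫ * ⟪v σ, h⟫‖ := (summable_mehler hr hv g h).norm
  have h2 : ∑' σ, ‖r ^ σ * ⟪v σ, g⟫ * ⟪v σ, h⟫‖ ≤ ‖g‖ * ‖h‖ :=
    Real.tsum_le_of_sum_le (fun _ => norm_nonneg _) (abs_sum_le_norm_mul_norm hr hv g h)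
  rw [one_mul]
  exact (norm_tsum_le_tsum_norm h1).trans h2

/-- The Mehler form as a bounded bilinear form. -/
noncomputable def mehlerForm {r : ℝ} (hr : |r| ≤ 1) (hv : Orthonormal ℝ v) :
    H →L[ℝ] H →L[ℝ] ℝ :=
  LinearMap.mkContinuous₂ (mehlerBilin hr hv) 1 (norm_mehlerBilin_le hr hv)

end MehlerForm

lemma mehlerForm_expLp {r : ℝ} (hr : |r| ≤ 1) (a b : ℝ) :
    mehlerForm hr orthonormal_hermiteLp (expLp a) (expLp b) = Real.exp ((a ^ 2 + b ^ 2 + 2 * a * b * r) / 2) := by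
  change ∑' σ, r ^ σ * ⟪hermiteLp σ, expLp a⟫ * ⟪hermiteLp σ, expLp b⟫ = _
  have h : ∀ σ : ℕ, r ^ σ * ⟪hermiteLp σ, expLp a⟫ * ⟪hermiteLp σ, expLp b⟫
      = Real.exp ((a ^ 2 + b ^ 2) / 2) * ((a * b * r) ^ σ / σ.factorial) := by
    intro σ
    rw [inner_hermiteLp_expLp, inner_hermiteLp_expLp, add_div, Real.exp_add, mul_pow, mul_pow]
    have : (0 : ℝ) < σ.factorial := by positivity
    have h3 := (Real.sqrt_pos.2 this).ne'
    have h2 := Real.sq_sqrt this.le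
    field_simp
    rw [h2]
    ring
  simp_rw [h]
  rw [tsum_mul_left, ← congrFun (NormedSpace.exp_eq_tsum_div (𝔸 := ℝ)) (a * b * r),
    ← Real.exp_eq_exp_ℝ, ← Real.exp_add]
  ring_nf

/-- `X` and `Y` are standard Gaussian variables, jointly Gaussian with correlation `r`. -/
structure IsStdGaussianPair {Ω : Type*} [MeasurableSpace Ω] (P : Measure Ω) (X Y : Ω → ℝ)
    (r : ℝ) : Prop where
  measurable_left : Measurable X
  measurable_right : Measurable Y
  gaussian : ∀ a b : ℝ, ∃ v : NNReal, P.map (fun ω => a * X ω + b * Y ω) = gaussianReal 0 v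
  sq_left : ∫ ω, X ω ^ 2 ∂P = 1
  sq_right : ∫ ω, Y ω ^ 2 ∂P = 1
  cov : ∫ ω, X ω * Y ω ∂P = r

namespace IsStdGaussianPair

variable {Ω : Type*} [MeasurableSpace Ω] {P : Measure Ω} {X Y : Ω → ℝ} {r : ℝ}

lemma integral_sq (hp : IsStdGaussianPair P X Y r) (a b : ℝ) :
    ∫ ω, (a * X ω + b * Y ω) ^ 2 ∂P = a ^ 2 + b ^ 2 + 2 * a * b * r := by
  obtain ⟨hX, hY, -, hX2, hY2, hXY⟩ := hp
  have hmemX : MemLp X 2 P := by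
    rw [memLp_two_iff_integrable_sq hX.aestronglyMeasurable]
    exact Integrable.of_integral_ne_zero (by rw [hX2]; norm_num)
  have hmemY : MemLp Y 2 P := by
    rw [memLp_two_iff_integrable_sq hY.aestronglyMeasurable]
    exact Integrable.of_integral_ne_zero (by rw [hY2]; norm_num)
  have i1 := hmemX.integrable_sq.const_mul (a ^ 2)
  have i2 := hmemY.integrable_sq.const_mul (b ^ 2)
  have i12 : Integrable (fun ω => a ^ 2 * X ω ^ 2 + b ^ 2 * Y ω ^ 2) P := i1.add i2
  have i3 : Integrable (fun ω => 2 * a * b * (X ω * Y ω)) P :=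
    (hmemX.integrable_mul hmemY).const_mul (2 * a * b)
  have e : ∀ ω, (a * X ω + b * Y ω) ^ 2
      = a ^ 2 * X ω ^ 2 + b ^ 2 * Y ω ^ 2 + 2 * a * b * (X ω * Y ω) := by
    intro ω; ring
  simp_rw [e]
  rw [integral_add i12 i3, integral_add i1 i2, integral_const_mul, integral_const_mul,
    integral_const_mul, hX2, hY2, hXY]
  ring

lemma variance_nonneg (hp : IsStdGaussianPair P X Y r) (a b : ℝ) :
    0 ≤ a ^ 2 + b ^ 2 + 2 * a * b * r := by
  rw [← hp.integral_sq]
  exact integral_nonneg fun _ => sq_nonneg _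

lemma abs_corr_le_one (hp : IsStdGaussianPair P X Y r) : |r| ≤ 1 := by
  rw [abs_le]
  have h1 := hp.variance_nonneg 1 1
  have h2 := hp.variance_nonneg 1 (-1)
  constructor <;> linarith

lemma map_eq (hp : IsStdGaussianPair P X Y r) (a b : ℝ) :
    P.map (fun ω => a * X ω + b * Y ω)
      = gaussianReal 0 (a ^ 2 + b ^ 2 + 2 * a * b * r).toNNReal := by
  obtain ⟨v, hv⟩ := hp.gaussian a b
  have hX := hp.measurable_left
  have hY := hp.measurable_right
  have hm : Measurable fun ω => a * X ω + b * Y ω := by fun_prop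
  have h2 : ∫ x, x ^ 2 ∂(gaussianReal 0 v) = v := by
    have := variance_id_gaussianReal (μ := 0) (v := v)
    rw [variance_of_integral_eq_zero (by fun_prop) (by simp)] at this
    simpa using this
  rw [← hv, integral_map hm.aemeasurable (by fun_prop), hp.integral_sq] at h2
  rw [hv]
  congr 1
  rw [h2, Real.toNNReal_coe]

lemma measurePreserving_left (hp : IsStdGaussianPair P X Y r) :
    MeasurePreserving X P (gaussianReal 0 1) :=
  ⟨hp.measurable_left, by simpa using hp.map_eq 1 0⟩

lemma measurePreserving_right (hp : IsStdGaussianPair P X Y r) :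
    MeasurePreserving Y P (gaussianReal 0 1) :=
  ⟨hp.measurable_right, by simpa using hp.map_eq 0 1⟩

/-- **Mehler's formula** for a standard bivariate Gaussian pair with correlation `r`. -/
theorem hasSum_mehler (hp : IsStdGaussianPair P X Y r) {h : ℝ → ℝ}
    (hh : MemLp h 2 (gaussianReal 0 1)) {C : ℕ → ℝ}
    (hC : ∀ σ, C σ = ∫ u, h u * (hermiteFun σ u / Real.sqrt σ.factorial) ∂(gaussianReal 0 1)) :
    HasSum (fun σ => C σ ^ 2 * r ^ σ) (∫ ω, h (X ω) * h (Y ω) ∂P) := by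
  have hr := hp.abs_corr_le_one
  have hpX := hp.measurePreserving_left
  have hpY := hp.measurePreserving_right
  let U := (Lp.compMeasurePreservingₗᵢ (E := ℝ) (p := 2) ℝ X hpX).toContinuousLinearMap
  let V := (Lp.compMeasurePreservingₗᵢ (E := ℝ) (p := 2) ℝ Y hpY).toContinuousLinearMap
  have hUV {g k : ℝ → ℝ} (hg : MemLp g 2 (gaussianReal 0 1)) (hk : MemLp k 2 (gaussianReal 0 1)) :
      ⟪U hg.toLp, V hk.toLp⟫ = ∫ ω, g (X ω) * k (Y ω) ∂P := by
    have e1 : U hg.toLp = (hg.comp_measurePreserving hpX).toLp :=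
      Lp.toLp_compMeasurePreserving hg hpX
    have e2 : V hk.toLp = (hk.comp_measurePreserving hpY).toLp :=
      Lp.toLp_compMeasurePreserving hk hpY
    rw [e1, e2, inner_toLp]
    rfl
  let Q : Lp ℝ 2 (gaussianReal 0 1) →L[ℝ] Lp ℝ 2 (gaussianReal 0 1) →L[ℝ] ℝ :=
    (innerSL ℝ).bilinearComp U V
  have hQ : mehlerForm hr orthonormal_hermiteLp = Q := by
    refine ContinuousLinearMap.ext_on dense_span_expLp ?_
    rintro _ ⟨a, rfl⟩
    refine ContinuousLinearMap.ext_on dense_span_expLp ?_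
    rintro _ ⟨b, rfl⟩
    rw [mehlerForm_expLp]
    change _ = ⟪U (expLp a), V (expLp b)⟫
    rw [expLp, expLp, hUV]
    have := mgf_gaussianReal (hp.map_eq a b) 1
    simp only [mgf, one_mul] at this
    simp_rw [← Real.exp_add, this]
    rw [Real.coe_toNNReal _ (hp.variance_nonneg a b)]
    ring_nf
  have hs := (summable_mehler hr orthonormal_hermiteLp hh.toLp hh.toLp).hasSum
  have he : ∑' σ, r ^ σ * ⟪hermiteLp σ, hh.toLp⟫ * ⟪hermiteLp σ, hh.toLp⟫
      = ∫ ω, h (X ω) * h (Y ω) ∂P := by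
    rw [← hUV hh hh]
    exact congrArg (fun T => T hh.toLp hh.toLp) hQ
  rw [he] at hs
  convert hs using 2 with σ
  rw [inner_hermiteLp_toLp, ← hC]
  ring

end IsStdGaussianPair

/-! ### Slowly varying functions and regularly decaying covariances -/

namespace SlowlyVaryingAtTop

variable {L : ℝ → ℝ}

lemma tendsto_div (hL : SlowlyVaryingAtTop L) {c : ℝ} (hc : 0 < c) :
    Tendsto (fun y => L (c * y) / L y) atTop (𝓝 1) :=
  (hL c (c + 1) hc (by linarith)).tendsto_at (Set.left_mem_Icc.2 (by linarith))

/-- Potter's bounds. -/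
lemma potter (hL : SlowlyVaryingAtTop L) (hLpos : ∀ y > 0, 0 < L y) {η : ℝ} (hη : 0 < η) :
    ∃ Y > 0, ∀ y ≥ Y, ∀ c ≥ 1,
      L (c * y) ≤ 2 ^ η * c ^ η * L y ∧ L y ≤ 2 ^ η * c ^ η * L (c * y) := by
  have h2 : (1 : ℝ) < 2 ^ η := Real.one_lt_rpow (by norm_num) hη
  set K : ℝ := 2 ^ η with hK
  have hδ : 0 < 1 - K⁻¹ := by
    have := inv_lt_one_of_one_lt₀ h2
    linarith
  have hev := (Metric.tendstoUniformlyOn_iff.1 (hL 1 2 one_pos one_lt_two)) _ hδ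
  obtain ⟨Y, hY⟩ := eventually_atTop.1 hev
  have key : ∀ y, max Y 1 ≤ y → ∀ c ∈ Set.Icc (1 : ℝ) 2, L (c * y) ≤ K * L y ∧ L y ≤ K * L (c * y) := by
    intro y hy c hc
    have hy0 : 0 < L y := hLpos y (by linarith [le_max_right Y 1])
    have h := hY y (le_of_max_le_left hy) c hc
    rw [Real.dist_eq, abs_lt] at h
    have hKK : 1 - K⁻¹ ≤ K - 1 := by
      have : K * K⁻¹ = 1 := mul_inv_cancel₀ (by positivity)
      nlinarith [sq_nonneg (K - 1), inv_pos.2 (zero_lt_one.trans h2)]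
    constructor
    · rw [← div_le_iff₀ hy0]
      linarith
    · have h3 : K⁻¹ ≤ L (c * y) / L y := by linarith
      rw [le_div_iff₀ hy0, inv_mul_le_iff₀ (by positivity)] at h3
      exact h3
  refine ⟨max Y 1, by positivity, ?_⟩
  have ind : ∀ k : ℕ, ∀ y, max Y 1 ≤ y → ∀ c ∈ Set.Icc (1 : ℝ) (2 ^ k),
      L (c * y) ≤ K * c ^ η * L y ∧ L y ≤ K * c ^ η * L (c * y) := by
    intro k
    induction k with
    | zero =>
      intro y hy c hc
      have hy0 : 0 < L y := hLpos y (by linarith [le_max_right Y 1])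
      have : c = 1 := le_antisymm (by simpa using hc.2) hc.1
      subst this
      simp only [one_mul, Real.one_rpow, mul_one]
      constructor <;> nlinarith
    | succ k ih =>
      intro y hy c hc
      have hy1 : 1 ≤ y := (le_max_right Y 1).trans hy
      have hc0 : 0 < c := by linarith [hc.1]
      have hLy : 0 < L y := hLpos y (by linarith)
      have hLcy : 0 < L (c * y) := hLpos _ (by positivity)
      rcases le_total c 2 with h | h
      · have hcη : 1 ≤ c ^ η := Real.one_le_rpow hc.1 hη.le
        obtain ⟨h3, h4⟩ := key y hy c ⟨hc.1, h⟩
        constructor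
        · refine h3.trans ?_
          gcongr
          exact le_mul_of_one_le_right (by positivity) hcη
        · refine h4.trans ?_
          gcongr
          exact le_mul_of_one_le_right (by positivity) hcη
      · obtain ⟨h3, h4⟩ := key y hy 2 ⟨by norm_num, le_rfl⟩
        obtain ⟨h5, h6⟩ := ih (2 * y) (by linarith) (c / 2)
          ⟨by linarith, by have := hc.2; rw [pow_succ] at this; linarith⟩
        have e : c / 2 * (2 * y) = c * y := by ring
        have e2 : (c / 2) ^ η * K = c ^ η := by
          rw [hK, ← Real.mul_rpow (by positivity) (by norm_num)]
          congr 1; ring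
        rw [e] at h5 h6
        have hp : 0 < (c / 2) ^ η := by positivity
        have hK0 : 0 < K := by positivity
        constructor
        · calc L (c * y) ≤ K * (c / 2) ^ η * L (2 * y) := h5
            _ ≤ K * (c / 2) ^ η * (K * L y) := by gcongr
            _ = K * ((c / 2) ^ η * K) * L y := by ring
            _ = _ := by rw [e2]
        · calc L y ≤ K * L (2 * y) := h4
            _ ≤ K * (K * (c / 2) ^ η * L (c * y)) := by gcongr
            _ = K * ((c / 2) ^ η * K) * L (c * y) := by ring
            _ = _ := by rw [e2]
  intro y hy c hc
  obtain ⟨k, hk⟩ := pow_unbounded_of_one_lt c (one_lt_two (α := ℝ))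
  exact ind k y hy c ⟨hc, hk.le⟩

/-- A slowly varying function is bounded above and below by small powers. -/
lemma rpow_bounds (hL : SlowlyVaryingAtTop L) (hLpos : ∀ y > 0, 0 < L y) {η : ℝ} (hη : 0 < η) :
    ∃ Y > 0, ∃ D > 0, ∀ y ≥ Y, L y ≤ D * y ^ η ∧ 1 ≤ D * y ^ η * L y := by
  obtain ⟨Y, hY, h⟩ := hL.potter hLpos hη
  have hLY := hLpos Y hY
  refine ⟨Y, hY, 2 ^ η * (Y ^ η)⁻¹ * max (L Y) (L Y)⁻¹, by positivity, fun y hy => ?_⟩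
  have hy0 : 0 < y := hY.trans_le hy
  obtain ⟨h1, h2⟩ := h Y le_rfl (y / Y) ((one_le_div hY).2 hy)
  rw [div_mul_cancel₀ _ hY.ne', Real.div_rpow hy0.le hY.le] at h1 h2
  have hLy := hLpos y hy0
  have hYη : 0 < Y ^ η := by positivity
  constructor
  · refine h1.trans ?_
    calc 2 ^ η * (y ^ η / Y ^ η) * L Y = 2 ^ η * (Y ^ η)⁻¹ * L Y * y ^ η := by ring
      _ ≤ _ := by gcongr; exact le_max_left _ _
  · calc (1 : ℝ) = (L Y)⁻¹ * L Y := (inv_mul_cancel₀ hLY.ne').symm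
      _ ≤ (L Y)⁻¹ * (2 ^ η * (y ^ η / Y ^ η) * L y) := by gcongr
      _ = 2 ^ η * (Y ^ η)⁻¹ * (L Y)⁻¹ * y ^ η * L y := by ring
      _ ≤ _ := by gcongr; exact le_max_right _ _

end SlowlyVaryingAtTop

section RegularDecay

variable {E : Type*} [NormedAddCommGroup E] [NormedSpace ℝ E] {L : ℝ → ℝ} {R : E → ℝ} {κ : ℝ}

lemma tendsto_norm_smul_atTop {w : E} (hw : w ≠ 0) :
    Tendsto (fun y : ℝ => ‖y • w‖) atTop atTop := by
  simp only [norm_smul, Real.norm_eq_abs]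
  exact tendsto_abs_atTop_atTop.atTop_mul_const (norm_pos_iff.2 hw)

lemma tendsto_covariance_ratio (hLpos : ∀ y > 0, 0 < L y) (hL : SlowlyVaryingAtTop L)
    (hR : Tendsto (fun z : E => R z * ‖z‖ ^ κ / L ‖z‖) (comap norm atTop) (𝓝 1))
    {w : E} (hw : w ≠ 0) :
    Tendsto (fun y : ℝ => R (y • w) / (y ^ (-κ) * L y)) atTop (𝓝 (‖w‖ ^ (-κ))) := by
  have hw0 := norm_pos_iff.2 hw
  have h1 : Tendsto (fun y : ℝ => R (y • w) * ‖y • w‖ ^ κ / L ‖y • w‖) atTop (𝓝 1) :=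
    hR.comp (tendsto_comap_iff.2 (tendsto_norm_smul_atTop hw))
  have h2 := (h1.mul (hL.tendsto_div hw0)).mul_const (‖w‖ ^ (-κ))
  rw [one_mul, one_mul] at h2
  refine h2.congr' ?_
  filter_upwards [eventually_gt_atTop 0] with y hy
  have e : ‖y • w‖ = ‖w‖ * y := by rw [norm_smul, Real.norm_of_nonneg hy.le, mul_comm]
  have h3 := hLpos y hy
  have h4 := hLpos (‖w‖ * y) (by positivity)
  have h5 : 0 < y ^ κ := by positivity
  have h6 : 0 < ‖w‖ ^ κ := by positivity
  rw [e, Real.mul_rpow hw0.le hy.le, Real.rpow_neg hw0.le, Real.rpow_neg hy.le]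
  field_simp

lemma tendsto_rpow_neg_mul_slowlyVarying (hκ : 0 < κ) (hLpos : ∀ y > 0, 0 < L y)
    (hL : SlowlyVaryingAtTop L) : Tendsto (fun y : ℝ => y ^ (-κ) * L y) atTop (𝓝 0) := by
  obtain ⟨Y, hY, D, hD, h⟩ := hL.rpow_bounds hLpos (half_pos hκ)
  have h0 : Tendsto (fun y : ℝ => D * y ^ (-(κ / 2))) atTop (𝓝 0) := by
    simpa using (tendsto_rpow_neg_atTop (half_pos hκ)).const_mul D
  refine squeeze_zero' ?_ ?_ h0
  · filter_upwards [eventually_gt_atTop 0] with y hy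
    have := hLpos y hy
    positivity
  · filter_upwards [eventually_ge_atTop Y] with y hy
    have hy0 : 0 < y := hY.trans_le hy
    calc y ^ (-κ) * L y ≤ y ^ (-κ) * (D * y ^ (κ / 2)) := by gcongr; exact (h y hy).1
      _ = D * (y ^ (-κ) * y ^ (κ / 2)) := by ring
      _ = _ := by rw [← Real.rpow_add hy0]; ring_nf

/-- The scaling limit of a function of the covariance which vanishes to order `m` at zero. -/
lemma tendsto_scaled_covariance (hκ : 0 < κ) (hLpos : ∀ y > 0, 0 < L y)
    (hL : SlowlyVaryingAtTop L)
    (hR : Tendsto (fun z : E => R z * ‖z‖ ^ κ / L ‖z‖) (comap norm atTop) (𝓝 1))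
    (hR1 : ∀ z, |R z| ≤ 1) {g : ℝ → ℝ} {c K : ℝ} {m : ℕ}
    (hg : ∀ r, |r| ≤ 1 → |g r - c * r ^ m| ≤ K * |r| ^ (m + 1)) {w : E} (hw : w ≠ 0) :
    Tendsto (fun y : ℝ => g (R (y • w)) / (y ^ (-κ) * L y) ^ m) atTop
      (𝓝 (c * ‖w‖ ^ (-(m * κ)))) := by
  have h1 := tendsto_covariance_ratio hLpos hL hR hw
  have h2 := tendsto_rpow_neg_mul_slowlyVarying hκ hLpos hL
  have h3 : Tendsto (fun y : ℝ => R (y • w)) atTop (𝓝 0) := by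
    have := h1.mul h2
    rw [mul_zero] at this
    refine this.congr' ?_
    filter_upwards [eventually_gt_atTop 0] with y hy
    have := hLpos y hy
    have : 0 < y ^ (-κ) := by positivity
    field_simp
  have h4 : Tendsto (fun y : ℝ => c * (R (y • w) / (y ^ (-κ) * L y)) ^ m) atTop
      (𝓝 (c * ‖w‖ ^ (-(m * κ)))) := by
    have := (h1.pow m).const_mul c
    rwa [← Real.rpow_mul_natCast (norm_nonneg w), neg_mul, mul_comm κ] at this
  have h5 : Tendsto (fun y : ℝ => K * |R (y • w)| * |R (y • w) / (y ^ (-κ) * L y)| ^ m) atTop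
      (𝓝 0) := by
    have := ((h3.abs.const_mul K).mul (h1.abs.pow m))
    simpa using this
  refine tendsto_of_tendsto_of_dist h4 (squeeze_zero' (Eventually.of_forall fun _ => dist_nonneg)
    ?_ h5)
  filter_upwards [eventually_gt_atTop 0] with y hy
  have hA : 0 < y ^ (-κ) * L y := by
    have := hLpos y hy
    positivity
  rw [dist_comm, Real.dist_eq]
  have e : g (R (y • w)) / (y ^ (-κ) * L y) ^ m - c * (R (y • w) / (y ^ (-κ) * L y)) ^ m
      = (g (R (y • w)) - c * R (y • w) ^ m) / (y ^ (-κ) * L y) ^ m := by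
    rw [div_pow]; ring
  rw [e, abs_div, abs_div, abs_of_pos (pow_pos hA m), div_pow, abs_of_pos hA]
  calc _ ≤ K * |R (y • w)| ^ (m + 1) / (y ^ (-κ) * L y) ^ m := by
        gcongr
        exact hg _ (hR1 _)
    _ = _ := by ring

lemma covariance_ratio_le (hLpos : ∀ y > 0, 0 < L y)
    (hL : SlowlyVaryingAtTop L)
    (hR : Tendsto (fun z : E => R z * ‖z‖ ^ κ / L ‖z‖) (comap norm atTop) (𝓝 1))
    (hR1 : ∀ z, |R z| ≤ 1) {η : ℝ} (hη : 0 < η) (hηκ : η < κ) :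
    ∃ D > 0, ∃ Y > 0, ∀ y ≥ Y, ∀ w : E, w ≠ 0 →
      |R (y • w)| / (y ^ (-κ) * L y) ≤ D * max 1 (‖w‖ ^ (-(κ + η))) := by
  obtain ⟨Y₁, hY₁, hP⟩ := hL.potter hLpos hη
  obtain ⟨Y₂, hY₂, D, hD, hB⟩ := hL.rpow_bounds hLpos hη
  have hR2 : ∀ᶠ z : E in comap norm atTop, R z * ‖z‖ ^ κ / L ‖z‖ ∈ Metric.ball 1 1 :=
    hR.eventually (Metric.ball_mem_nhds _ one_pos)
  rw [eventually_comap] at hR2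
  obtain ⟨M₀, hM₀⟩ := eventually_atTop.1 hR2
  set M := max M₀ (max Y₁ Y₂) with hM
  have hMY₁ : Y₁ ≤ M := (le_max_left _ _).trans (le_max_right _ _)
  have hM0 : 0 < M := hY₁.trans_le hMY₁
  have hRM : ∀ z : E, M ≤ ‖z‖ → |R z| * ‖z‖ ^ κ ≤ 2 * L ‖z‖ := by
    intro z hz
    have h := hM₀ ‖z‖ ((le_max_left _ _).trans hz) z rfl
    rw [Metric.mem_ball, Real.dist_eq, abs_lt] at h
    have hz0 : 0 < ‖z‖ := hM0.trans_le hz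
    have hLz := hLpos _ hz0
    have : |R z * ‖z‖ ^ κ / L ‖z‖| ≤ 2 := abs_le.2 ⟨by linarith, by linarith⟩
    rwa [abs_div, abs_of_pos hLz, div_le_iff₀ hLz, abs_mul, abs_of_pos (Real.rpow_pos_of_pos hz0 κ)] at this
  refine ⟨2 * 2 ^ η + D * M ^ (κ + η), by positivity, M, hM0, fun y hy w hw => ?_⟩
  have hw0 := norm_pos_iff.2 hw
  have hy0 : 0 < y := hM0.trans_le hy
  have hLy := hLpos y hy0
  have hyw : ‖y • w‖ = ‖w‖ * y := by rw [norm_smul, Real.norm_of_nonneg hy0.le, mul_comm]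
  have hmax0 : 0 < max 1 (‖w‖ ^ (-(κ + η))) := by positivity
  rw [div_le_iff₀ (by positivity)]
  rcases le_or_gt M (‖w‖ * y) with hc | hc
  · have h1 := hRM (y • w) (hyw.symm ▸ hc)
    rw [hyw, Real.mul_rpow hw0.le hy0.le] at h1
    have h2 : |R (y • w)| ≤ 2 * L (‖w‖ * y) * ‖w‖ ^ (-κ) * y ^ (-κ) := by
      rw [Real.rpow_neg hw0.le, Real.rpow_neg hy0.le]
      have : 0 < ‖w‖ ^ κ * y ^ κ := by positivity
      rw [← le_div_iff₀ this] at h1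
      refine h1.trans (le_of_eq ?_)
      field_simp
    have h3 : L (‖w‖ * y) * ‖w‖ ^ (-κ) ≤ 2 ^ η * max 1 (‖w‖ ^ (-(κ + η))) * L y := by
      rcases le_total 1 ‖w‖ with h | h
      · have := (hP y (hMY₁.trans hy) ‖w‖ h).1
        have hle : ‖w‖ ^ η * ‖w‖ ^ (-κ) ≤ 1 := by
          rw [← Real.rpow_add hw0]
          exact Real.rpow_le_one_of_one_le_of_nonpos h (by linarith)
        calc L (‖w‖ * y) * ‖w‖ ^ (-κ) ≤ 2 ^ η * ‖w‖ ^ η * L y * ‖w‖ ^ (-κ) := by gcongr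
          _ = 2 ^ η * (‖w‖ ^ η * ‖w‖ ^ (-κ)) * L y := by ring
          _ ≤ 2 ^ η * 1 * L y := by gcongr
          _ ≤ _ := by gcongr; exact le_max_left _ _
      · have := (hP (‖w‖ * y) (hMY₁.trans hc) ‖w‖⁻¹ (by
          exact (one_le_inv₀ hw0).2 h)).2
        rw [inv_mul_cancel_left₀ hw0.ne', Real.inv_rpow hw0.le, ← Real.rpow_neg hw0.le] at this
        calc L (‖w‖ * y) * ‖w‖ ^ (-κ) ≤ 2 ^ η * ‖w‖ ^ (-η) * L y * ‖w‖ ^ (-κ) := by gcongr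
          _ = 2 ^ η * (‖w‖ ^ (-κ) * ‖w‖ ^ (-η)) * L y := by ring
          _ = 2 ^ η * (‖w‖ ^ (-(κ + η))) * L y := by
            rw [← Real.rpow_add hw0]
            ring_nf
          _ ≤ _ := by gcongr; exact le_max_right _ _
    calc |R (y • w)| ≤ 2 * L (‖w‖ * y) * ‖w‖ ^ (-κ) * y ^ (-κ) := h2
      _ = 2 * (L (‖w‖ * y) * ‖w‖ ^ (-κ)) * y ^ (-κ) := by ring
      _ ≤ 2 * (2 ^ η * max 1 (‖w‖ ^ (-(κ + η))) * L y) * y ^ (-κ) := by gcongr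
      _ = 2 * 2 ^ η * max 1 (‖w‖ ^ (-(κ + η))) * (y ^ (-κ) * L y) := by ring
      _ ≤ _ := by
        gcongr
        exact le_add_of_nonneg_right (by positivity)
  · have h1 := (hB y ((le_max_right _ _).trans ((le_max_right _ _).trans hy))).2
    have h2 : y ^ (κ + η) ≤ M ^ (κ + η) * ‖w‖ ^ (-(κ + η)) := by
      rw [Real.rpow_neg hw0.le, ← div_eq_mul_inv, ← Real.div_rpow hM0.le hw0.le]
      refine Real.rpow_le_rpow hy0.le ?_ (by linarith)
      rw [le_div_iff₀ hw0]
      linarith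
    calc |R (y • w)| ≤ 1 := hR1 _
      _ ≤ D * y ^ η * L y := h1
      _ = D * y ^ (κ + η) * (y ^ (-κ) * L y) := by
        have : y ^ η = y ^ (κ + η) * y ^ (-κ) := by
          rw [← Real.rpow_add hy0]; ring_nf
        rw [this]; ring
      _ ≤ D * (M ^ (κ + η) * ‖w‖ ^ (-(κ + η))) * (y ^ (-κ) * L y) := by gcongr
      _ = D * M ^ (κ + η) * ‖w‖ ^ (-(κ + η)) * (y ^ (-κ) * L y) := by ring
      _ ≤ _ := by
        gcongr
        · exact le_add_of_nonneg_left (by positivity)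
        · exact le_max_right _ _

lemma scaled_covariance_le (hLpos : ∀ y > 0, 0 < L y)
    (hL : SlowlyVaryingAtTop L)
    (hR : Tendsto (fun z : E => R z * ‖z‖ ^ κ / L ‖z‖) (comap norm atTop) (𝓝 1))
    (hR1 : ∀ z, |R z| ≤ 1) {g : ℝ → ℝ} {K : ℝ} (hK : 0 ≤ K) {m : ℕ}
    (hg : ∀ r, |r| ≤ 1 → |g r| ≤ K * |r| ^ m) {η : ℝ} (hη : 0 < η) (hηκ : η < κ) :
    ∃ D > 0, ∃ Y > 0, ∀ y ≥ Y, ∀ w : E, w ≠ 0 →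
      |g (R (y • w)) / (y ^ (-κ) * L y) ^ m| ≤ D * (1 + ‖w‖ ^ (-(m * (κ + η)))) := by
  obtain ⟨D, hD, Y, hY, h⟩ := covariance_ratio_le hLpos hL hR hR1 hη hηκ
  refine ⟨(K + 1) * D ^ m, by positivity, Y, hY, fun y hy w hw => ?_⟩
  have hy0 : 0 < y := hY.trans_le hy
  have hLy := hLpos y hy0
  have hA : 0 < y ^ (-κ) * L y := by positivity
  have hw0 := norm_pos_iff.2 hw
  have hmax : (max 1 (‖w‖ ^ (-(κ + η)))) ^ m ≤ 1 + ‖w‖ ^ (-(m * (κ + η))) := by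
    have e : (‖w‖ ^ (-(κ + η))) ^ m = ‖w‖ ^ (-(m * (κ + η))) := by
      rw [← Real.rpow_mul_natCast hw0.le]
      ring_nf
    rcases max_cases 1 (‖w‖ ^ (-(κ + η))) with ⟨h1, -⟩ | ⟨h1, -⟩ <;> rw [h1]
    · rw [one_pow]
      exact le_add_of_nonneg_right (by positivity)
    · rw [e]
      linarith
  rw [abs_div, abs_of_pos (pow_pos hA m)]
  calc |g (R (y • w))| / (y ^ (-κ) * L y) ^ m
      ≤ K * |R (y • w)| ^ m / (y ^ (-κ) * L y) ^ m := by
        gcongr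
        exact hg _ (hR1 _)
    _ = K * (|R (y • w)| / (y ^ (-κ) * L y)) ^ m := by rw [div_pow]; ring
    _ ≤ (K + 1) * (D * max 1 (‖w‖ ^ (-(κ + η)))) ^ m := by
        gcongr
        · linarith
        · exact h y hy w hw
    _ = (K + 1) * D ^ m * (max 1 (‖w‖ ^ (-(κ + η)))) ^ m := by rw [mul_pow]; ring
    _ ≤ _ := by gcongr

end RegularDecay

/-! ### Riesz potentials -/

/-- Mixing an integrable function over a nonnegative kernel. -/
lemma integral_integral_mul_kernel {S X : Type*} [MeasurableSpace S] [MeasurableSpace X]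
    {ρ : Measure S} {ν : Measure X} [SFinite ρ] [SFinite ν] {g : X → ℂ} {k : S → X → ℝ}
    {K : X → ℝ} (hk : Measurable (Function.uncurry k)) (hk0 : ∀ᵐ x ∂ν, ∀ᵐ s ∂ρ, 0 ≤ k s x)
    (hK : ∀ᵐ x ∂ν, Integrable (fun s => k s x) ρ ∧ ∫ s, k s x ∂ρ = K x)
    (hg : AEStronglyMeasurable g ν) (hgK : Integrable (fun x => g x * K x) ν) :
    ∫ s, ∫ x, g x * k s x ∂ν ∂ρ = ∫ x, g x * K x ∂ν := by
  have hm : AEStronglyMeasurable (Function.uncurry fun s x => g x * (k s x : ℂ)) (ρ.prod ν) :=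
    hg.comp_snd.mul (Complex.measurable_ofReal.comp hk).aestronglyMeasurable
  have hint : Integrable (Function.uncurry fun s x => g x * (k s x : ℂ)) (ρ.prod ν) := by
    rw [integrable_prod_iff' hm]
    constructor
    · filter_upwards [hK] with x hx
      exact hx.1.ofReal.const_mul (g x)
    · refine hgK.norm.congr ?_
      filter_upwards [hK, hk0] with x hx hx0
      simp only [Function.uncurry, norm_mul, Complex.norm_real]
      rw [integral_const_mul, ← hx.2, Real.norm_of_nonneg (integral_nonneg_of_ae hx0)]
      congr 1
      refine integral_congr_ae ?_
      filter_upwards [hx0] with s hs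
      rw [Real.norm_of_nonneg hs]
  rw [integral_integral_swap hint]
  refine integral_congr_ae ?_
  filter_upwards [hK] with x hx
  rw [integral_const_mul, integral_complex_ofReal, hx.2]

section Euclidean

variable {n : ℕ}

local notation "𝔼" => EuclideanSpace ℝ (Fin n)

lemma integrableOn_norm_rpow_neg (hn : 1 ≤ n) {p : ℝ} (hp : p < n) :
    IntegrableOn (fun w : 𝔼 => ‖w‖ ^ (-p)) (Metric.ball 0 1) := by
  have : Nontrivial 𝔼 := by
    have : Nonempty (Fin n) := ⟨⟨0, hn⟩⟩
    infer_instance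
  rw [integrableOn_fun_norm_addHaar (μ := (volume : Measure 𝔼)) (f := fun r : ℝ => r ^ (-p))]
  have h1 : IntegrableOn (fun y : ℝ => y ^ ((n : ℝ) - 1 - p)) (Set.Ioo 0 1) := by
    rw [intervalIntegral.integrableOn_Ioo_rpow_iff one_pos]
    linarith
  refine h1.congr_fun (fun y hy => ?_) measurableSet_Ioo
  have hd : Module.finrank ℝ 𝔼 = n := by simp
  rw [hd, smul_eq_mul, ← Real.rpow_natCast, ← Real.rpow_add hy.1, Nat.cast_sub hn, Nat.cast_one,
    sub_eq_add_neg ((n : ℝ) - 1)]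

lemma integrable_mul_norm_rpow_neg (hn : 1 ≤ n) {p : ℝ} (hp0 : 0 ≤ p) (hp : p < n) {φ : 𝔼 → ℝ}
    (hφ : Integrable φ) {K : ℝ} (hK : ∀ w, |φ w| ≤ K) :
    Integrable (fun w : 𝔼 => φ w * ‖w‖ ^ (-p)) := by
  have h1 : Integrable (fun w : 𝔼 => K * (Metric.ball (0 : 𝔼) 1).indicator (fun w => ‖w‖ ^ (-p)) w
      + |φ w|) :=
    (((integrable_indicator_iff Metric.isOpen_ball.measurableSet).2
      (integrableOn_norm_rpow_neg hn hp)).const_mul K).add hφ.abs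
  refine h1.mono' (hφ.1.mul (by exact (measurable_norm.pow_const _).aestronglyMeasurable)) (ae_of_all _ fun w => ?_)
  have hK0 : 0 ≤ K := (abs_nonneg _).trans (hK 0)
  rw [norm_mul, Real.norm_eq_abs, Real.norm_of_nonneg (by positivity)]
  by_cases hw : w ∈ Metric.ball (0 : 𝔼) 1
  · rw [Set.indicator_of_mem hw]
    have := hK w
    have h0 : 0 ≤ ‖w‖ ^ (-p) := by positivity
    nlinarith [abs_nonneg (φ w)]
  · rw [Set.indicator_of_notMem hw, mul_zero, zero_add]
    rw [mem_ball_zero_iff, not_lt] at hw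
    exact mul_le_of_le_one_right (abs_nonneg _)
      (Real.rpow_le_one_of_one_le_of_nonpos hw (by linarith))

lemma integrable_mul_norm_add_rpow_neg (hn : 1 ≤ n) {p : ℝ} (hp0 : 0 ≤ p) (hp : p < n) {φ : 𝔼 → ℝ}
    (hφ : Integrable φ) {K : ℝ} (hK : ∀ w, |φ w| ≤ K) (z : 𝔼) :
    Integrable (fun w : 𝔼 => φ w * ‖z + w‖ ^ (-p)) := by
  have := (integrable_mul_norm_rpow_neg hn hp0 hp (hφ.comp_add_left (-z))
    (fun w => hK (-z + w))).comp_add_left z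
  simpa using this

lemma integral_cexp_mul_gaussian {s : ℝ} (hs : 0 < s) (v : 𝔼) :
    ∫ τ : 𝔼, Complex.exp (⟪τ, v⟫ * Complex.I) * Real.exp (-(s * ‖τ‖ ^ 2))
      = ((Real.pi / s) ^ ((n : ℝ) / 2) * Real.exp (-(‖v‖ ^ 2 / (4 * s))) : ℝ) := by
  have h := GaussianFourier.integral_cexp_neg_mul_sq_norm_add_of_euclideanSpace (ι := Fin n)
    (b := (s : ℂ)) (by simpa using hs) Complex.I v
  rw [Fintype.card_fin] at h
  convert h using 1
  · refine integral_congr_ae (ae_of_all _ fun τ => ?_)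
    simp only
    rw [Complex.ofReal_exp, ← Complex.exp_add, real_inner_comm]
    congr 1
    push_cast
    ring
  · push_cast
    rw [Complex.ofReal_cpow (by positivity)]
    push_cast
    congr 2
    rw [Complex.I_sq]
    ring

lemma integrable_cexp_mul {f : 𝔼 → ℂ} (hf : Integrable f) (z : 𝔼) :
    Integrable fun τ : 𝔼 => Complex.exp (⟪τ, z⟫ * Complex.I) * f τ := by
  refine hf.bdd_mul (c := 1) (by fun_prop) (ae_of_all _ fun τ => ?_)
  rw [Complex.norm_exp_ofReal_mul_I]

lemma integrable_gaussian_norm {s : ℝ} (hs : 0 < s) :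
    Integrable fun τ : 𝔼 => Real.exp (-(s * ‖τ‖ ^ 2)) := by
  have h := (GaussianFourier.integrable_cexp_neg_mul_sq_norm_add_of_euclideanSpace (ι := Fin n)
    (b := (s : ℂ)) (by simpa using hs) 0 0).norm
  refine h.congr (ae_of_all _ fun τ => ?_)
  simp only
  rw [Complex.norm_exp]
  congr 1
  simp [← Complex.ofReal_pow]

lemma integral_fourier_mul_gaussian {φ : 𝔼 → ℝ} (hφ : Integrable φ) {ψ : 𝔼 → ℂ}
    (hψ : ∀ τ, ψ τ = ∫ w, Complex.exp (⟪w, τ⟫ * Complex.I) * φ w) (z : 𝔼) {s : ℝ} (hs : 0 < s) :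
    ∫ τ, Complex.exp (⟪τ, z⟫ * Complex.I) * ψ τ * Real.exp (-(s * ‖τ‖ ^ 2))
      = ∫ w, (φ w : ℂ) *
        ((Real.pi / s) ^ ((n : ℝ) / 2) * Real.exp (-(‖z + w‖ ^ 2 / (4 * s))) : ℝ) := by
  simp_rw [← integral_cexp_mul_gaussian hs, hψ, ← integral_const_mul, ← integral_mul_const]
  have hint : Integrable (Function.uncurry fun (τ w : 𝔼) =>
      Complex.exp (⟪τ, z⟫ * Complex.I) * (Complex.exp (⟪w, τ⟫ * Complex.I) * φ w)
        * Real.exp (-(s * ‖τ‖ ^ 2))) (volume.prod volume) := by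
    have h1 : Integrable (fun q : 𝔼 × 𝔼 => (Real.exp (-(s * ‖q.1‖ ^ 2)) : ℂ) * (φ q.2 : ℂ))
        (volume.prod volume) := (integrable_gaussian_norm hs).ofReal.mul_prod hφ.ofReal
    refine (h1.bdd_mul (c := 1) (f := fun q : 𝔼 × 𝔼 =>
      Complex.exp (⟪q.1, z⟫ * Complex.I) * Complex.exp (⟪q.2, q.1⟫ * Complex.I)) (by fun_prop)
      (ae_of_all _ fun q => ?_)).congr (ae_of_all _ fun q => ?_)
    · simp only [norm_mul, Complex.norm_exp_ofReal_mul_I, mul_one, le_refl]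
    · simp only [Function.uncurry]
      ring
  rw [integral_integral_swap hint]
  refine integral_congr_ae (ae_of_all _ fun w => integral_congr_ae (ae_of_all _ fun τ => ?_))
  simp only [inner_add_right, Complex.ofReal_add, add_mul, Complex.exp_add]
  rw [real_inner_comm w τ]
  ring

lemma integral_rpow_mul_exp_neg_div {a r : ℝ} (ha : 0 < a) (hr : 0 < r) :
    ∫ s in Set.Ioi (0 : ℝ), s ^ (-a - 1) * Real.exp (-(r / s)) = (1 / r) ^ a * Real.Gamma a := by
  rw [← Real.integral_rpow_mul_exp_neg_mul_Ioi ha hr,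
    ← integral_comp_rpow_Ioi (fun t : ℝ => t ^ (a - 1) * Real.exp (-(r * t)))
      (p := -1) (by norm_num)]
  refine setIntegral_congr_fun measurableSet_Ioi fun s hs => ?_
  have hs0 : (0 : ℝ) < s := hs
  simp only [abs_neg, abs_one, one_mul, smul_eq_mul]
  rw [← mul_assoc, ← Real.rpow_mul hs0.le, ← Real.rpow_add hs0, Real.rpow_neg_one]
  ring_nf

/-- The Fourier transform of the Riesz kernel, tested against a Fourier pair. -/
theorem tauberK_mul_integral_riesz (hn : 1 ≤ n) {a : ℝ} (ha : 0 < a) (han : a < n) {φ : 𝔼 → ℝ}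
    (hφ : Integrable φ) {K : ℝ} (hK : ∀ w, |φ w| ≤ K) {ψ : 𝔼 → ℂ} (hψi : Integrable ψ)
    (hψ : ∀ τ, ψ τ = ∫ w, Complex.exp (⟪w, τ⟫ * Complex.I) * φ w) (z : 𝔼) :
    tauberK n a * ∫ τ, Complex.exp (⟪τ, z⟫ * Complex.I) * ψ τ * (‖τ‖ ^ (a - n) : ℝ)
      = ∫ w, ((φ w * ‖z + w‖ ^ (-a) : ℝ) : ℂ) := by
  have hb : 0 < ((n : ℝ) - a) / 2 := by linarith
  have ha2 : 0 < a / 2 := by linarith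
  have : Nontrivial 𝔼 := by
    have : Nonempty (Fin n) := ⟨⟨0, hn⟩⟩
    infer_instance
  have hψb : ∀ τ, ‖ψ τ‖ ≤ ∫ w, |φ w| := by
    intro τ
    rw [hψ]
    refine (norm_integral_le_integral_norm _).trans (le_of_eq ?_)
    refine integral_congr_ae (ae_of_all _ fun w => ?_)
    simp only [norm_mul, Complex.norm_exp_ofReal_mul_I, one_mul, Complex.norm_real,
      Real.norm_eq_abs]
  have hψr : Integrable (fun τ : 𝔼 => ‖ψ τ‖ * ‖τ‖ ^ (-((n : ℝ) - a))) :=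
    integrable_mul_norm_rpow_neg hn (by linarith) (by linarith) hψi.norm
      (K := ∫ w, |φ w|) (fun w => by rw [abs_of_nonneg (norm_nonneg _)]; exact hψb w)
  have hG1 := Real.Gamma_pos_of_pos hb
  have hG2 := Real.Gamma_pos_of_pos ha2
  have hg : AEStronglyMeasurable (fun τ : 𝔼 => Complex.exp (⟪τ, z⟫ * Complex.I) * ψ τ) volume :=
    (integrable_cexp_mul hψi z).1
  have L1 := integral_integral_mul_kernel (ρ := volume.restrict (Set.Ioi (0 : ℝ)))
    (ν := (volume : Measure 𝔼)) (g := fun τ => Complex.exp (⟪τ, z⟫ * Complex.I) * ψ τ)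
    (k := fun s τ => s ^ (((n : ℝ) - a) / 2 - 1) * Real.exp (-(‖τ‖ ^ 2 * s)))
    (K := fun τ => Real.Gamma (((n : ℝ) - a) / 2) * ‖τ‖ ^ (a - n))
    (by fun_prop)
    (ae_of_all _ fun τ => by
      filter_upwards [ae_restrict_mem measurableSet_Ioi] with s hs
      have : (0 : ℝ) < s := hs
      positivity)
    (by
      filter_upwards [compl_mem_ae_iff.2 (measure_singleton (0 : 𝔼))] with τ hτ
      have hτ0 : 0 < ‖τ‖ := norm_pos_iff.2 hτ
      have e := Real.integral_rpow_mul_exp_neg_mul_Ioi hb (r := ‖τ‖ ^ 2) (by positivity)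
      refine ⟨Integrable.of_integral_ne_zero (by rw [e]; positivity), ?_⟩
      rw [e, one_div, Real.inv_rpow (by positivity), ← Real.rpow_neg (by positivity),
        ← Real.rpow_natCast, ← Real.rpow_mul hτ0.le, mul_comm]
      congr 2
      push_cast
      ring) hg (by
      refine ((hψr.const_mul (Real.Gamma (((n : ℝ) - a) / 2))).mono
        (hg.mul (by exact (Complex.measurable_ofReal.comp
          ((measurable_norm.pow_const _).const_mul _)).aestronglyMeasurable))
        (ae_of_all _ fun τ => le_of_eq ?_))
      simp only [norm_mul, Complex.norm_exp_ofReal_mul_I, one_mul, Complex.norm_real, norm_norm,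
        neg_sub]
      ring)
  have L2 := integral_integral_mul_kernel (ρ := volume.restrict (Set.Ioi (0 : ℝ)))
    (ν := (volume : Measure 𝔼)) (g := fun w => (φ w : ℂ))
    (k := fun s w => Real.pi ^ ((n : ℝ) / 2) *
      (s ^ (-(a / 2) - 1) * Real.exp (-(‖z + w‖ ^ 2 / 4 / s))))
    (K := fun w => Real.pi ^ ((n : ℝ) / 2) * (2 ^ a * Real.Gamma (a / 2)) * ‖z + w‖ ^ (-a))
    (by fun_prop)
    (ae_of_all _ fun τ => by
      filter_upwards [ae_restrict_mem measurableSet_Ioi] with s hs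
      have : (0 : ℝ) < s := hs
      positivity)
    (by
      filter_upwards [compl_mem_ae_iff.2 (measure_singleton (-z))] with w hw
      have hw0 : 0 < ‖z + w‖ := norm_pos_iff.2 fun h => hw (eq_neg_of_add_eq_zero_right h)
      have e := integral_rpow_mul_exp_neg_div ha2 (r := ‖z + w‖ ^ 2 / 4) (by positivity)
      refine ⟨(Integrable.of_integral_ne_zero (by rw [e]; positivity)).const_mul _, ?_⟩
      rw [integral_const_mul, e, mul_assoc]
      congr 1
      rw [one_div, Real.inv_rpow (by positivity), ← Real.rpow_neg (by positivity),
        Real.div_rpow (by positivity) (by positivity),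
        ← Real.rpow_natCast, ← Real.rpow_mul hw0.le]
      have e4 : (4 : ℝ) ^ (-(a / 2)) = (2 ^ a)⁻¹ := by
        rw [show (4 : ℝ) = 2 ^ (2 : ℝ) by norm_num, ← Real.rpow_mul (by norm_num),
          ← Real.rpow_neg (by norm_num)]
        ring_nf
      rw [e4, div_inv_eq_mul]
      have : (((2 : ℕ) : ℝ) * -(a / 2)) = -a := by push_cast; ring
      rw [this]
      ring) hφ.ofReal.1 (by
      have : Integrable (fun w : 𝔼 => ((Real.pi ^ ((n : ℝ) / 2) * (2 ^ a * Real.Gamma (a / 2)) *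
          (φ w * ‖z + w‖ ^ (-a)) : ℝ) : ℂ)) :=
        ((integrable_mul_norm_add_rpow_neg hn ha.le han hφ hK z).const_mul _).ofReal
      refine this.congr (ae_of_all _ fun w => ?_)
      push_cast
      ring)
  have L12 : ∫ s in Set.Ioi (0 : ℝ), ∫ τ : 𝔼, Complex.exp (⟪τ, z⟫ * Complex.I) * ψ τ *
        (s ^ (((n : ℝ) - a) / 2 - 1) * Real.exp (-(‖τ‖ ^ 2 * s)) : ℝ)
      = ∫ s in Set.Ioi (0 : ℝ), ∫ w : 𝔼, (φ w : ℂ) * (Real.pi ^ ((n : ℝ) / 2) *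
      (s ^ (-(a / 2) - 1) * Real.exp (-(‖z + w‖ ^ 2 / 4 / s))) : ℝ) := by
    refine setIntegral_congr_fun measurableSet_Ioi fun s hs => ?_
    have hs0 : (0 : ℝ) < s := hs
    have e := congrArg (fun c : ℂ => ((s ^ (((n : ℝ) - a) / 2 - 1) : ℝ) : ℂ) * c)
      (integral_fourier_mul_gaussian hφ hψ z hs0)
    simp only [← integral_const_mul] at e
    refine Eq.trans ?_ (e.trans ?_)
    · refine integral_congr_ae (ae_of_all _ fun τ => ?_)
      simp only
      rw [mul_comm s]
      push_cast
      ring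
    · refine integral_congr_ae (ae_of_all _ fun w => ?_)
      simp only
      have e1 : s ^ (-(a / 2) - 1) = s ^ (((n : ℝ) - a) / 2 - 1) * s ^ (-((n : ℝ) / 2)) := by
        rw [← Real.rpow_add hs0]
        ring_nf
      rw [Real.div_rpow Real.pi_pos.le hs0.le, e1, Real.rpow_neg hs0.le,
        show ‖z + w‖ ^ 2 / 4 / s = ‖z + w‖ ^ 2 / (4 * s) by rw [div_div]]
      push_cast
      ring
  rw [L1, L2] at L12
  set A : ℂ := ∫ τ, Complex.exp (⟪τ, z⟫ * Complex.I) * ψ τ * (‖τ‖ ^ (a - n) : ℝ) with hA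
  set B : ℂ := ∫ w, ((φ w * ‖z + w‖ ^ (-a) : ℝ) : ℂ) with hB
  have hA' : ((Real.Gamma (((n : ℝ) - a) / 2) : ℝ) : ℂ) * A
      = ((Real.pi ^ ((n : ℝ) / 2) * (2 ^ a * Real.Gamma (a / 2)) : ℝ) : ℂ) * B := by
    rw [hA, hB, ← integral_const_mul, ← integral_const_mul]
    refine Eq.trans ?_ (L12.trans ?_)
    · refine integral_congr_ae (ae_of_all _ fun τ => ?_)
      simp only
      push_cast
      ring
    · refine integral_congr_ae (ae_of_all _ fun w => ?_)
      simp only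
      push_cast
      ring
  have hc : (0 : ℝ) < Real.pi ^ ((n : ℝ) / 2) * (2 ^ a * Real.Gamma (a / 2)) := by positivity
  have hc' : ((Real.pi ^ ((n : ℝ) / 2) * (2 ^ a * Real.Gamma (a / 2)) : ℝ) : ℂ) ≠ 0 :=
    Complex.ofReal_ne_zero.2 hc.ne'
  rw [tauberK, show (2 : ℝ) ^ a * Real.pi ^ ((n : ℝ) / 2) * Real.Gamma (a / 2)
    = Real.pi ^ ((n : ℝ) / 2) * (2 ^ a * Real.Gamma (a / 2)) by ring, Complex.ofReal_div,
    div_mul_eq_mul_div, hA', mul_div_cancel_left₀ _ hc']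

end Euclidean

/-! ### A product Fourier pair with polynomial decay -/

section LaplaceKernel

variable {n : ℕ}

local notation "𝔼" => EuclideanSpace ℝ (Fin n)

/-- The product Laplace density. -/
noncomputable def laplaceKer (w : 𝔼) : ℝ := ∏ i, 2⁻¹ * Real.exp (-|w i|)

/-- The product Cauchy kernel, which is the characteristic function of the Laplace density. -/
noncomputable def cauchyKer (τ : 𝔼) : ℝ := ∏ i, (1 + τ i ^ 2)⁻¹

lemma integral_euclidean_prod (f : Fin n → ℝ → ℂ) :
    ∫ w : 𝔼, ∏ i, f i (w i) = ∏ i, ∫ x, f i x := by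
  rw [← integral_fintype_prod_volume_eq_prod (E := fun _ : Fin n => ℝ) f]
  exact (PiLp.volume_preserving_ofLp (Fin n)).integral_comp
    (MeasurableEquiv.toLp 2 _).symm.measurableEmbedding (fun x : Fin n → ℝ => ∏ i, f i (x i))

lemma integrable_euclidean_prod {f : ℝ → ℝ} (hf : Integrable f) :
    Integrable fun w : 𝔼 => ∏ i, f (w i) :=
  ((PiLp.volume_preserving_ofLp (Fin n)).integrable_comp_emb
    (MeasurableEquiv.toLp 2 _).symm.measurableEmbedding
    (g := fun x : Fin n → ℝ => ∏ i, f (x i))).2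
    (Integrable.fintype_prod (μ := fun _ : Fin n => (volume : Measure ℝ)) (f := fun _ => f)
      fun _ => hf)

lemma integrable_exp_neg_abs : Integrable fun x : ℝ => Real.exp (-|x|) := by
  rw [← integrableOn_univ, ← Set.Iic_union_Ioi (a := (0 : ℝ))]
  refine IntegrableOn.union ?_ ?_
  · exact (integrableOn_exp_Iic 0).congr_fun (fun x hx => by
      simp [abs_of_nonpos (Set.mem_Iic.1 hx)]) measurableSet_Iic
  · exact (integrableOn_exp_neg_Ioi 0).congr_fun (fun x hx => by
      simp [abs_of_pos (Set.mem_Ioi.1 hx)]) measurableSet_Ioi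

lemma integral_cexp_mul_exp_neg_abs (t : ℝ) :
    ∫ x : ℝ, Complex.exp ((x * t : ℝ) * Complex.I) * (2⁻¹ * Real.exp (-|x|) : ℝ)
      = ((1 + t ^ 2)⁻¹ : ℝ) := by
  have hi : Integrable fun x : ℝ =>
      Complex.exp ((x * t : ℝ) * Complex.I) * (2⁻¹ * Real.exp (-|x|) : ℝ) := by
    refine (integrable_exp_neg_abs.const_mul 2⁻¹).ofReal.bdd_mul (c := 1) (by fun_prop)
      (ae_of_all _ fun x => ?_)
    rw [Complex.norm_exp_ofReal_mul_I]
  have hp : 0 < (1 + t * Complex.I).re := by simp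
  have hm : (-1 + t * Complex.I).re < 0 := by simp
  have h1 : ∫ x in Set.Iic (0 : ℝ),
      Complex.exp ((x * t : ℝ) * Complex.I) * (2⁻¹ * Real.exp (-|x|) : ℝ)
      = 2⁻¹ * (1 / (1 + t * Complex.I)) := by
    have := integral_exp_mul_complex_Iic hp 0
    rw [Complex.ofReal_zero, mul_zero, Complex.exp_zero] at this
    rw [← this, ← integral_const_mul]
    refine setIntegral_congr_fun measurableSet_Iic fun x hx => ?_
    rw [abs_of_nonpos (Set.mem_Iic.1 hx), neg_neg, add_mul, Complex.exp_add]
    push_cast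
    ring_nf
  have h2 : ∫ x in Set.Ioi (0 : ℝ),
      Complex.exp ((x * t : ℝ) * Complex.I) * (2⁻¹ * Real.exp (-|x|) : ℝ)
      = 2⁻¹ * (-1 / (-1 + t * Complex.I)) := by
    have := integral_exp_mul_complex_Ioi hm 0
    rw [Complex.ofReal_zero, mul_zero, Complex.exp_zero] at this
    rw [← this, ← integral_const_mul]
    refine setIntegral_congr_fun measurableSet_Ioi fun x hx => ?_
    rw [abs_of_pos (Set.mem_Ioi.1 hx), add_mul, Complex.exp_add]
    push_cast
    ring_nf
  rw [← intervalIntegral.integral_Iic_add_Ioi hi.integrableOn hi.integrableOn, h1, h2]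
  have hp' : (1 + t * Complex.I) ≠ 0 := fun h => by rw [h] at hp; simp at hp
  have hm' : (-1 + t * Complex.I) ≠ 0 := fun h => by rw [h] at hm; simp at hm
  have h3 : ((1 + t ^ 2 : ℝ) : ℂ) ≠ 0 := by
    rw [Complex.ofReal_ne_zero]; positivity
  have h4 : ((1 + t ^ 2 : ℝ) : ℂ) = -((1 + t * Complex.I) * (-1 + t * Complex.I)) := by
    push_cast
    ring_nf
    rw [Complex.I_sq]
    ring
  rw [Complex.ofReal_inv, h4]
  field_simp
  ring

lemma integral_cexp_mul_laplaceKer (τ : 𝔼) :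
    ∫ w : 𝔼, Complex.exp (⟪w, τ⟫ * Complex.I) * laplaceKer w = cauchyKer τ := by
  rw [cauchyKer, Complex.ofReal_prod]
  simp_rw [← integral_cexp_mul_exp_neg_abs]
  rw [← integral_euclidean_prod
    (fun i x => Complex.exp ((x * τ i : ℝ) * Complex.I) * (2⁻¹ * Real.exp (-|x|) : ℝ))]
  refine integral_congr_ae (ae_of_all _ fun w => ?_)
  simp only [Finset.prod_mul_distrib, ← Complex.exp_sum, ← Finset.sum_mul, laplaceKer]
  congr 3
  · rw [PiLp.inner_apply]
    simp [mul_comm]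
  · rw [← Finset.prod_mul_distrib, Complex.ofReal_prod]

lemma integrable_laplaceKer : Integrable (laplaceKer : 𝔼 → ℝ) :=
  integrable_euclidean_prod (integrable_exp_neg_abs.const_mul 2⁻¹)

lemma laplaceKer_nonneg (w : 𝔼) : 0 ≤ laplaceKer w :=
  Finset.prod_nonneg fun _ _ => by positivity

lemma abs_laplaceKer_le_one (w : 𝔼) : |laplaceKer w| ≤ 1 := by
  rw [abs_of_nonneg (laplaceKer_nonneg w)]
  refine Finset.prod_le_one (fun _ _ => by positivity) fun i _ => ?_
  have : Real.exp (-|w i|) ≤ 1 := Real.exp_le_one_iff.2 (by simp)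
  linarith

lemma integrable_cauchyKer : Integrable (cauchyKer : 𝔼 → ℝ) :=
  integrable_euclidean_prod integrable_inv_one_add_sq

lemma cauchyKer_pos (τ : 𝔼) : 0 < cauchyKer τ :=
  Finset.prod_pos fun _ _ => by positivity

lemma continuous_cauchyKer : Continuous (cauchyKer : 𝔼 → ℝ) := by
  unfold cauchyKer
  refine continuous_finsetProd _ fun i _ => ?_
  refine Continuous.inv₀ (by fun_prop) fun τ => by positivity

lemma cauchyKer_le_one (τ : 𝔼) : cauchyKer τ ≤ 1 :=
  Finset.prod_le_one (fun _ _ => by positivity) fun i _ =>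
    inv_le_one_of_one_le₀ (by nlinarith [sq_nonneg (τ i)])

lemma inv_cauchyKer_le (τ : 𝔼) : (cauchyKer τ)⁻¹ ≤ (1 + ‖τ‖ ^ 2) ^ n := by
  rw [cauchyKer, Finset.prod_inv_distrib, inv_inv]
  calc ∏ i, (1 + τ i ^ 2) ≤ ∏ _i : Fin n, (1 + ‖τ‖ ^ 2) := by
        refine Finset.prod_le_prod (fun _ _ => by positivity) fun i _ => ?_
        have := PiLp.norm_apply_le τ i
        rw [Real.norm_eq_abs] at this
        gcongr 1 + ?_
        exact sq_le_sq.2 (by rwa [abs_norm])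
    _ = _ := by simp

end LaplaceKernel

/-! ### Convergence of spectral integrals -/

/-- Lévy's continuity theorem for finite measures with a nonzero limit. -/
lemma tendsto_integral_of_tendsto_charFun {E : Type*} [NormedAddCommGroup E]
    [InnerProductSpace ℝ E] [FiniteDimensional ℝ E] [MeasurableSpace E] [BorelSpace E]
    {ρ : ℕ → Measure E} {ρ₀ : Measure E} [∀ k, IsFiniteMeasure (ρ k)] [IsFiniteMeasure ρ₀]
    (h₀ : ρ₀ ≠ 0) (h : ∀ z, Tendsto (fun k => charFun (ρ k) z) atTop (𝓝 (charFun ρ₀ z)))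
    (g : BoundedContinuousFunction E ℂ) :
    Tendsto (fun k => ∫ x, g x ∂ρ k) atTop (𝓝 (∫ x, g x ∂ρ₀)) := by
  let r : ℕ → FiniteMeasure E := fun k => ⟨ρ k, inferInstance⟩
  let r₀ : FiniteMeasure E := ⟨ρ₀, inferInstance⟩
  suffices Tendsto r atTop (𝓝 r₀) from
    (FiniteMeasure.tendsto_iff_forall_integral_rclike_tendsto ℂ).1 this g
  have hr₀ : r₀ ≠ 0 := fun H => h₀ (congrArg (fun ν : FiniteMeasure E => (ν : Measure E)) H)
  have hmass : ∀ ν : FiniteMeasure E, charFun (ν : Measure E) 0 = ((ν.mass : ℝ) : ℂ) := by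
    intro ν
    rw [charFun_zero]
    rfl
  have hm : Tendsto (fun k => (r k).mass) atTop (𝓝 r₀.mass) := by
    have h0 := h 0
    change Tendsto (fun k => charFun (r k : Measure E) 0) atTop (𝓝 (charFun (r₀ : Measure E) 0))
      at h0
    simp only [hmass] at h0
    have := (Complex.continuous_re.tendsto _).comp h0
    exact NNReal.tendsto_coe.1 (by simpa [Function.comp_def] using this)
  have hm0 : r₀.mass ≠ 0 := r₀.mass_nonzero_iff.2 hr₀
  have hnorm : ∀ ν : FiniteMeasure E, ν ≠ 0 → ∀ z, charFun (ν.normalize : Measure E) z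
      = ((ν.mass : ℝ) : ℂ)⁻¹ * charFun (ν : Measure E) z := by
    intro ν hν z
    rw [ν.toMeasure_normalize_eq_of_nonzero hν, charFun_apply, charFun_apply,
      integral_smul_nnreal_measure, NNReal.smul_def, Complex.real_smul]
    push_cast
    rfl
  refine FiniteMeasure.tendsto_of_tendsto_normalize_testAgainstNN_of_tendsto_mass ?_ hm
  refine ProbabilityMeasure.tendsto_of_tendsto_charFun fun z => ?_
  rw [hnorm r₀ hr₀]
  have hev : ∀ᶠ k in atTop, ((r k).mass : ℂ)⁻¹ * charFun (r k : Measure E) z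
      = charFun ((r k).normalize : Measure E) z := by
    filter_upwards [hm.eventually_ne hm0] with k hk
    exact (hnorm (r k) ((r k).mass_nonzero_iff.1 hk) z).symm
  refine Tendsto.congr' hev (Tendsto.mul (Tendsto.inv₀ ?_ ?_) (h z))
  · exact (Complex.continuous_ofReal.tendsto _).comp ((NNReal.tendsto_coe).2 hm)
  · exact_mod_cast hm0


lemma integral_withDensity_ofReal {X : Type*} [MeasurableSpace X] {ν : Measure X} {d : X → ℝ}
    (hd : Measurable d) (hd0 : ∀ x, 0 ≤ d x) (G : X → ℂ) :
    ∫ x, G x ∂ν.withDensity (fun x => ENNReal.ofReal (d x)) = ∫ x, (d x : ℂ) * G x ∂ν := by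
  rw [integral_withDensity_eq_integral_toReal_smul hd.ennreal_ofReal
    (ae_of_all _ fun _ => ENNReal.ofReal_lt_top)]
  refine integral_congr_ae (ae_of_all _ fun x => ?_)
  simp only [ENNReal.toReal_ofReal (hd0 x), Complex.real_smul]

lemma tauberK_pos {n : ℕ} {a : ℝ} (ha : 0 < a) (han : a < n) : 0 < tauberK n a := by
  have h1 : 0 < Real.Gamma (((n : ℝ) - a) / 2) := Real.Gamma_pos_of_pos (by linarith)
  have h2 : 0 < Real.Gamma (a / 2) := Real.Gamma_pos_of_pos (by linarith)
  unfold tauberK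
  positivity

section SpectralConvergence

variable {n : ℕ}

local notation "𝔼" => EuclideanSpace ℝ (Fin n)

lemma charFun_withDensity_cauchyKer (ν : Measure 𝔼) [IsFiniteMeasure ν] (z : 𝔼) :
    charFun (ν.withDensity fun τ => ENNReal.ofReal (cauchyKer τ)) z
      = ∫ w, (laplaceKer w : ℂ) * charFun ν (z + w) := by
  rw [charFun_apply, integral_withDensity_ofReal continuous_cauchyKer.measurable
    fun τ => (cauchyKer_pos τ).le]
  have h1 : ∀ τ : 𝔼, (cauchyKer τ : ℂ) * Complex.exp (⟪τ, z⟫ * Complex.I)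
      = ∫ w, (laplaceKer w : ℂ) * Complex.exp (⟪τ, z + w⟫ * Complex.I) := by
    intro τ
    rw [← integral_cexp_mul_laplaceKer, ← integral_mul_const]
    refine integral_congr_ae (ae_of_all _ fun w => ?_)
    simp only
    rw [inner_add_right, real_inner_comm τ w, Complex.ofReal_add, add_mul, Complex.exp_add]
    ring
  simp_rw [h1, charFun_apply, ← integral_const_mul]
  refine integral_integral_swap ?_
  have hl : Integrable (fun q : 𝔼 × 𝔼 => ((1 : ℝ) : ℂ) * (laplaceKer q.2 : ℂ)) (ν.prod volume) :=
    (integrable_const (((1 : ℝ) : ℂ))).mul_prod integrable_laplaceKer.ofReal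
  refine hl.mono ?_ (ae_of_all _ fun q => ?_)
  · refine AEStronglyMeasurable.mul ?_ ?_
    · exact (integrable_laplaceKer.ofReal (𝕜 := ℂ)).aestronglyMeasurable.comp_snd
    · exact Continuous.aestronglyMeasurable (by fun_prop)
  · simp only [Function.uncurry, norm_mul, Complex.norm_exp_ofReal_mul_I]
    simp

theorem tendsto_integral_spectral (hn : 1 ≤ n) {a p c D : ℝ} (ha : 0 < a) (han : a < n)
    (hp0 : 0 ≤ p) (hp : p < n) (hc : 0 < c) {ν : ℕ → Measure 𝔼} [∀ k, IsFiniteMeasure (ν k)]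
    {b : ℕ → 𝔼 → ℝ} (hb : ∀ k z, charFun (ν k) z = b k z)
    (hlim : ∀ w ≠ 0, Tendsto (fun k => b k w) atTop (𝓝 (c * ‖w‖ ^ (-a))))
    (hdom : ∀ᶠ k in atTop, ∀ w ≠ 0, |b k w| ≤ D * (1 + ‖w‖ ^ (-p)))
    {F : ℕ → 𝔼 → ℂ} (hF : ∀ k, Continuous (F k)) (g : BoundedContinuousFunction 𝔼 ℂ)
    (hFg : ∀ e > 0, ∀ᶠ k in atTop, ∀ τ, ‖F k τ - cauchyKer τ * g τ‖ ≤ e * cauchyKer τ) :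
    Tendsto (fun k => ∫ τ, F k τ ∂ν k) atTop
      (𝓝 (c * tauberK n a * ∫ τ, cauchyKer τ * g τ * (‖τ‖ ^ (a - n) : ℝ))) := by
  have : Nonempty (Fin n) := ⟨⟨0, hn⟩⟩
  have hK : 0 < tauberK n a := tauberK_pos ha han
  have hcm : Measurable (cauchyKer : 𝔼 → ℝ) := continuous_cauchyKer.measurable
  have hci : ∀ k, Integrable (cauchyKer : 𝔼 → ℝ) (ν k) := fun k =>
    Integrable.of_bound hcm.aestronglyMeasurable 1 (ae_of_all _ fun τ => by
      rw [Real.norm_eq_abs, abs_of_pos (cauchyKer_pos τ)]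
      exact cauchyKer_le_one τ)
  set d : 𝔼 → ℝ := fun τ => c * tauberK n a * (cauchyKer τ * ‖τ‖ ^ (a - n)) with hd
  have hdi : Integrable d := by
    have := integrable_mul_norm_rpow_neg hn (p := n - a) (by linarith) (by linarith)
      integrable_cauchyKer (K := 1) (fun w => by
        rw [abs_of_pos (cauchyKer_pos w)]
        exact cauchyKer_le_one w)
    simp only [neg_sub] at this
    exact this.const_mul _
  have hdm : Measurable d := (hcm.mul (measurable_norm.pow_const _)).const_mul _
  have hd0 : ∀ τ, 0 ≤ d τ := fun τ =>
    mul_nonneg (by positivity) (mul_nonneg (cauchyKer_pos τ).le (by positivity))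
  set ρ : ℕ → Measure 𝔼 := fun k => (ν k).withDensity fun τ => ENNReal.ofReal (cauchyKer τ)
    with hρ
  set ρ₀ : Measure 𝔼 := volume.withDensity fun τ => ENNReal.ofReal (d τ) with hρ₀
  have : ∀ k, IsFiniteMeasure (ρ k) := fun k =>
    isFiniteMeasure_withDensity_ofReal (hci k).2
  have : IsFiniteMeasure ρ₀ := isFiniteMeasure_withDensity_ofReal hdi.2
  have hne : ρ₀ ≠ 0 := by
    rw [hρ₀, Ne, withDensity_eq_zero_iff hdm.ennreal_ofReal.aemeasurable]
    intro H
    have h0 : ∀ᵐ τ : 𝔼, τ ≠ 0 := by simp [ae_iff]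
    have : ∀ᵐ _ : 𝔼, False := by
      filter_upwards [H, h0] with τ h1 h2
      have : 0 < d τ := mul_pos (by positivity)
        (mul_pos (cauchyKer_pos τ) (Real.rpow_pos_of_pos (norm_pos_iff.2 h2) _))
      exact absurd (ENNReal.ofReal_eq_zero.1 h1) (not_le.2 this)
    exact NeZero.ne (volume : Measure 𝔼) (by simpa using this)
  have hint : ∀ w : 𝔼, |laplaceKer w| ≤ 1 := abs_laplaceKer_le_one
  have hchar : ∀ z, Tendsto (fun k => charFun (ρ k) z) atTop (𝓝 (charFun ρ₀ z)) := by
    intro z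
    have h0 : charFun ρ₀ z = ∫ w, (laplaceKer w : ℂ) * ((c * ‖z + w‖ ^ (-a) : ℝ) : ℂ) := by
      have key := tauberK_mul_integral_riesz hn ha han integrable_laplaceKer hint
        (ψ := fun τ => (cauchyKer τ : ℂ)) integrable_cauchyKer.ofReal (fun τ => (integral_cexp_mul_laplaceKer τ).symm) z
      have e1 : ∫ w : 𝔼, (laplaceKer w : ℂ) * ((c * ‖z + w‖ ^ (-a) : ℝ) : ℂ)
          = c * ∫ w : 𝔼, ((laplaceKer w * ‖z + w‖ ^ (-a) : ℝ) : ℂ) := by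
        rw [← integral_const_mul]
        refine integral_congr_ae (ae_of_all _ fun w => ?_)
        simp only
        push_cast
        ring
      rw [e1, ← key, charFun_apply, integral_withDensity_ofReal hdm hd0, ← mul_assoc,
        ← integral_const_mul]
      refine integral_congr_ae (ae_of_all _ fun τ => ?_)
      simp only [hd]
      push_cast
      ring
    rw [h0]
    simp only [hρ, charFun_withDensity_cauchyKer, hb]
    have hz : ∀ᵐ w : 𝔼, z + w ≠ 0 := by
      have : ∀ᵐ w : 𝔼, w ≠ -z := by simp [ae_iff]
      filter_upwards [this] with w hw h
      exact hw (eq_neg_of_add_eq_zero_right h)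
    refine tendsto_integral_filter_of_dominated_convergence
      (fun w => laplaceKer w * (D * (1 + ‖z + w‖ ^ (-p)))) ?_ ?_ ?_ ?_
    · refine Eventually.of_forall fun k => ?_
      refine AEStronglyMeasurable.mul
        (integrable_laplaceKer.ofReal (𝕜 := ℂ)).aestronglyMeasurable ?_
      simp only [← hb]
      exact ((measurable_charFun (μ := ν k)).comp
        (measurable_const_add z)).aestronglyMeasurable
    · filter_upwards [hdom] with k hk
      filter_upwards [hz] with w hw
      rw [norm_mul, Complex.norm_real, Complex.norm_real, Real.norm_eq_abs,
        abs_of_nonneg (laplaceKer_nonneg w)]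
      exact mul_le_mul_of_nonneg_left (hk _ hw) (laplaceKer_nonneg w)
    · have h1 := (integrable_laplaceKer (n := n)).add
        (integrable_mul_norm_add_rpow_neg hn hp0 hp integrable_laplaceKer hint z)
      refine (h1.const_mul D).congr (ae_of_all _ fun w => ?_)
      simp only [Pi.add_apply]
      ring
    · filter_upwards [hz] with w hw
      exact ((Complex.continuous_ofReal.tendsto _).comp (hlim _ hw)).const_mul _
  have hg := tendsto_integral_of_tendsto_charFun hne hchar g
  have hρg : ∀ k, ∫ τ, g τ ∂ρ k = ∫ τ, (cauchyKer τ : ℂ) * g τ ∂ν k := fun k =>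
    integral_withDensity_ofReal hcm (fun τ => (cauchyKer_pos τ).le) _
  have hρ₀g : ∫ τ, g τ ∂ρ₀ = c * tauberK n a * ∫ τ, cauchyKer τ * g τ * (‖τ‖ ^ (a - n) : ℝ) := by
    rw [hρ₀, integral_withDensity_ofReal hdm hd0, ← integral_const_mul]
    refine integral_congr_ae (ae_of_all _ fun τ => ?_)
    simp only [hd]
    push_cast
    ring
  rw [← hρ₀g]
  have hmass : Tendsto (fun k => ∫ τ, cauchyKer τ ∂ν k) atTop (𝓝 (charFun ρ₀ 0).re) := by
    refine ((Complex.continuous_re.tendsto _).comp (hchar 0)).congr fun k => ?_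
    simp only [Function.comp, charFun_apply, hρ]
    rw [integral_withDensity_ofReal hcm fun τ => (cauchyKer_pos τ).le]
    simp only [inner_zero_right, Complex.ofReal_zero, zero_mul, Complex.exp_zero, mul_one]
    rw [integral_complex_ofReal, Complex.ofReal_re]
  have hdiff : Tendsto (fun k => (∫ τ, F k τ ∂ν k) - ∫ τ, g τ ∂ρ k) atTop (𝓝 0) := by
    rw [Metric.tendsto_nhds]
    intro e he
    set M := (charFun ρ₀ 0).re with hM
    have hM1 : 0 < |M| + 1 := by positivity
    filter_upwards [hFg (e / (2 * (|M| + 1))) (by positivity),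
      hmass.eventually_lt_const (lt_of_le_of_lt (le_abs_self M) (lt_add_one _))] with k hFe hk
    have hgi : Integrable (fun τ => (cauchyKer τ : ℂ) * g τ) (ν k) :=
      ((hci k).ofReal (𝕜 := ℂ)).mul_bdd (c := ‖g‖) g.continuous.aestronglyMeasurable
        (ae_of_all _ fun τ => g.norm_coe_le_norm τ)
    have hsi : Integrable (fun τ => F k τ - (cauchyKer τ : ℂ) * g τ) (ν k) := by
      refine ((hci k).const_mul (e / (2 * (|M| + 1)))).mono' ?_ (ae_of_all _ fun τ => hFe τ)
      exact (hF k).aestronglyMeasurable.sub hgi.aestronglyMeasurable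
    have hFi : Integrable (F k) (ν k) := by
      refine (hsi.add hgi).congr (ae_of_all _ fun τ => ?_)
      simp
    rw [dist_zero_right, hρg, ← integral_sub hFi hgi]
    calc ‖∫ τ, (F k τ - (cauchyKer τ : ℂ) * g τ) ∂ν k‖
        ≤ ∫ τ, e / (2 * (|M| + 1)) * cauchyKer τ ∂ν k :=
          norm_integral_le_of_norm_le ((hci k).const_mul _) (ae_of_all _ fun τ => hFe τ)
      _ = e / (2 * (|M| + 1)) * ∫ τ, cauchyKer τ ∂ν k := integral_const_mul _ _
      _ ≤ e / (2 * (|M| + 1)) * (|M| + 1) := by gcongr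
      _ < e := by
        rw [div_mul_eq_mul_div, div_lt_iff₀ (by positivity)]
        nlinarith
  simpa using hdiff.add hg

end SpectralConvergence

/-! ### Spectral measures of power series of a characteristic function -/

section SpectralMeasure

variable {E : Type*} [NormedAddCommGroup E] [InnerProductSpace ℝ E] [MeasurableSpace E]
  [BorelSpace E]

/-- Dilating and rescaling a finite measure acts on its characteristic function. -/
lemma exists_charFun_scaled (ν : Measure E) [IsFiniteMeasure ν] {A : ℝ} (hA : 0 ≤ A) (y : ℝ) :
    ∃ ν' : Measure E, IsFiniteMeasure ν' ∧ ∀ z, charFun ν' z = A * charFun ν (y • z) := by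
  refine ⟨A.toNNReal • ν.map (y • ·), inferInstance, fun z => ?_⟩
  rw [← charFun_map_smul, charFun_apply, charFun_apply, integral_smul_nnreal_measure,
    NNReal.smul_def, Complex.real_smul, Real.coe_toNNReal _ hA]

variable [SecondCountableTopology E]

lemma exists_charFun_pow (p : Measure E) [IsProbabilityMeasure p] (σ : ℕ) :
    ∃ ν : Measure E, IsProbabilityMeasure ν ∧ ∀ z, charFun ν z = charFun p z ^ σ := by
  induction σ with
  | zero => exact ⟨Measure.dirac 0, inferInstance, fun z => by simp [charFun_dirac]⟩
  | succ σ ih =>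
    obtain ⟨ν, hν, h⟩ := ih
    exact ⟨ν.conv p, inferInstance, fun z => by rw [charFun_conv, h, pow_succ]⟩

lemma exists_charFun_eq_tsum (p : Measure E) [IsProbabilityMeasure p] {c : ℕ → ℝ}
    (hc0 : ∀ σ, 0 ≤ c σ) (hc : Summable c) :
    ∃ ν : Measure E, IsFiniteMeasure ν ∧ ∀ z, charFun ν z = ∑' σ, (c σ : ℂ) * charFun p z ^ σ := by
  choose q hq hqc using exists_charFun_pow p
  have hfin : IsFiniteMeasure (Measure.sum fun σ => ENNReal.ofReal (c σ) • q σ) := by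
    constructor
    rw [Measure.sum_apply _ MeasurableSet.univ]
    simp only [Measure.smul_apply, measure_univ, smul_eq_mul, mul_one]
    rw [← ENNReal.ofReal_tsum_of_nonneg hc0 hc]
    exact ENNReal.ofReal_lt_top
  refine ⟨Measure.sum fun σ => ENNReal.ofReal (c σ) • q σ, hfin, fun z => ?_⟩
  rw [charFun_apply, integral_sum_measure]
  · refine tsum_congr fun σ => ?_
    rw [integral_smul_measure, ENNReal.toReal_ofReal (hc0 σ), ← hqc, charFun_apply,
      Complex.real_smul]
  · refine Integrable.of_bound (Continuous.aestronglyMeasurable (by fun_prop)) 1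
      (ae_of_all _ fun x => ?_)
    rw [Complex.norm_exp_ofReal_mul_I]

end SpectralMeasure

lemma exists_spectralMeasure {n : ℕ} {f R : EuclideanSpace ℝ (Fin n) → ℝ} (hfmeas : Measurable f)
    (hf0 : ∀ l, 0 ≤ f l) (hfi : Integrable f)
    (hRf : ∀ z, (R z : ℂ) = ∫ l, Complex.exp (Complex.I * ((⟪l, z⟫ : ℝ) : ℂ)) * f l)
    (hR0 : R 0 = 1) :
    ∃ p : Measure (EuclideanSpace ℝ (Fin n)), IsProbabilityMeasure p ∧ ∀ z, charFun p z = R z := by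
  have hfin : IsFiniteMeasure (volume.withDensity fun l => ENNReal.ofReal (f l)) :=
    isFiniteMeasure_withDensity_ofReal hfi.2
  have hch : ∀ z, charFun (volume.withDensity fun l => ENNReal.ofReal (f l)) z = R z := by
    intro z
    rw [charFun_apply, integral_withDensity_ofReal hfmeas hf0, hRf]
    refine integral_congr_ae (ae_of_all _ fun l => ?_)
    simp only
    rw [mul_comm, mul_comm Complex.I]
  refine ⟨_, ⟨?_⟩, hch⟩
  have h := hch 0
  rw [charFun_zero, hR0, Complex.ofReal_inj, Measure.real] at h
  rwa [ENNReal.toReal_eq_one_iff] at h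

/-! ### Convergence of the scaled symbols -/

section Symbol

lemma tendsto_one_add_sq_pow_mul_exp_neg {c q : ℝ} (hc : 0 < c) (hq : 0 < q) (n : ℕ) :
    Tendsto (fun r : ℝ => (1 + r ^ 2) ^ n * Real.exp (-(c * r ^ q))) atTop (𝓝 0) := by
  have h1 : Tendsto (fun r : ℝ => (2 : ℝ) ^ n * ((r ^ q) ^ ((2 * n : ℕ) / q : ℝ) *
      Real.exp (-c * r ^ q))) atTop (𝓝 0) := by
    simpa using ((tendsto_rpow_mul_exp_neg_mul_atTop_nhds_zero ((2 * n : ℕ) / q : ℝ) c hc).comp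
      (tendsto_rpow_atTop hq)).const_mul ((2 : ℝ) ^ n)
  refine squeeze_zero' (Eventually.of_forall fun r => by positivity) ?_ h1
  filter_upwards [eventually_ge_atTop 1] with r hr
  have hr0 : 0 ≤ r := by linarith
  rw [← Real.rpow_mul hr0, mul_div_cancel₀ _ hq.ne', Real.rpow_natCast, ← mul_assoc, pow_mul,
    ← mul_pow, neg_mul]
  gcongr
  nlinarith

variable {n : ℕ}

local notation "𝔼" => EuclideanSpace ℝ (Fin n)

variable {c α γ : ℝ}

lemma exp_symbol_le (hc : 0 < c) (hα : 0 < α) (hγ : 0 ≤ γ) (δ : ℝ) (τ : 𝔼) :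
    Real.exp (-(c * ‖τ‖ ^ α * (δ ^ 2 + ‖τ‖ ^ 2) ^ (γ / 2)))
      ≤ Real.exp (-(c * ‖τ‖ ^ (α + γ))) := by
  have h1 : ‖τ‖ ^ γ ≤ (δ ^ 2 + ‖τ‖ ^ 2) ^ (γ / 2) := by
    calc ‖τ‖ ^ γ = (‖τ‖ ^ 2) ^ (γ / 2) := by
          rw [← Real.rpow_natCast, ← Real.rpow_mul (norm_nonneg _)]
          congr 1
          push_cast
          ring
      _ ≤ _ := Real.rpow_le_rpow (by positivity) (by nlinarith [sq_nonneg δ]) (by positivity)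
  rw [Real.rpow_add_of_nonneg (norm_nonneg _) hα.le hγ, ← mul_assoc]
  gcongr

lemma exp_symbol_zero (hα : 0 < α) (hγ : 0 ≤ γ) (τ : 𝔼) :
    Real.exp (-(c * ‖τ‖ ^ α * ((0 : ℝ) ^ 2 + ‖τ‖ ^ 2) ^ (γ / 2)))
      = Real.exp (-(c * ‖τ‖ ^ (α + γ))) := by
  have h1 : ((0 : ℝ) ^ 2 + ‖τ‖ ^ 2) ^ (γ / 2) = ‖τ‖ ^ γ := by
    rw [zero_pow two_ne_zero, zero_add, ← Real.rpow_natCast, ← Real.rpow_mul (norm_nonneg _)]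
    congr 1
    push_cast
    ring
  rw [h1, Real.rpow_add_of_nonneg (norm_nonneg _) hα.le hγ, ← mul_assoc]

lemma continuous_exp_symbol (c : ℝ) (hα : 0 < α) (hγ : 0 ≤ γ) :
    Continuous fun q : ℝ × 𝔼 =>
      Real.exp (-(c * ‖q.2‖ ^ α * (q.1 ^ 2 + ‖q.2‖ ^ 2) ^ (γ / 2))) := by
  have h1 : Continuous fun q : ℝ × 𝔼 => ‖q.2‖ ^ α :=
    Continuous.rpow_const (by fun_prop) fun _ => Or.inr hα.le
  have h2 : Continuous fun q : ℝ × 𝔼 => (q.1 ^ 2 + ‖q.2‖ ^ 2) ^ (γ / 2) :=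
    Continuous.rpow_const (by fun_prop) fun _ => Or.inr (by positivity)
  fun_prop

lemma eventually_abs_symbol_sub_le (hc : 0 < c) (hα : 0 < α) (hγ : 0 ≤ γ) {e : ℝ} (he : 0 < e) :
    ∀ᶠ δ in 𝓝 (0 : ℝ), ∀ τ : 𝔼,
      |Real.exp (-(c * ‖τ‖ ^ α * (δ ^ 2 + ‖τ‖ ^ 2) ^ (γ / 2)))
        - Real.exp (-(c * ‖τ‖ ^ (α + γ)))| ≤ e * cauchyKer τ := by
  obtain ⟨r₀, hr₀⟩ := eventually_atTop.1
    ((tendsto_one_add_sq_pow_mul_exp_neg hc (add_pos_of_pos_of_nonneg hα hγ) n).eventually_le_const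
      he)
  set f : ℝ → 𝔼 → ℝ := fun δ τ => (cauchyKer τ)⁻¹ *
    Real.exp (-(c * ‖τ‖ ^ α * (δ ^ 2 + ‖τ‖ ^ 2) ^ (γ / 2))) with hf
  have hfc : Continuous (Function.uncurry f) :=
    ((continuous_cauchyKer.comp continuous_snd).inv₀ fun q => (cauchyKer_pos q.2).ne').mul
      (continuous_exp_symbol c hα hγ)
  obtain ⟨v, hv, hvf⟩ := IsCompact.mem_uniformity_of_prod (isCompact_closedBall (0 : 𝔼) r₀)
    (s := Set.univ) (q := (0 : ℝ)) hfc.continuousOn (Set.mem_univ _) (Metric.dist_mem_uniformity he)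
  rw [nhdsWithin_univ] at hv
  filter_upwards [hv] with δ hδ τ
  have hψ := cauchyKer_pos τ
  rcases le_total ‖τ‖ r₀ with h | h
  · have h1 := hvf δ hδ τ (by simpa using h)
    simp only [Set.mem_ofPred_eq, hf, Real.dist_eq, exp_symbol_zero hα hγ, ← mul_sub, abs_mul,
      abs_inv, abs_of_pos hψ] at h1
    rw [inv_mul_lt_iff₀ hψ] at h1
    linarith
  · have h1 := hr₀ ‖τ‖ h
    have h2 : Real.exp (-(c * ‖τ‖ ^ (α + γ))) ≤ e * cauchyKer τ := by
      rw [← div_le_iff₀ hψ, div_eq_mul_inv, mul_comm]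
      exact (mul_le_mul_of_nonneg_right (inv_cauchyKer_le τ) (Real.exp_pos _).le).trans h1
    have h3 := exp_symbol_le hc hα hγ δ τ
    have h4 := Real.exp_pos (-(c * ‖τ‖ ^ α * (δ ^ 2 + ‖τ‖ ^ 2) ^ (γ / 2)))
    rw [abs_le]
    constructor <;> linarith [Real.exp_pos (-(c * ‖τ‖ ^ (α + γ)))]

lemma exists_inv_cauchyKer_mul_exp_le (hc : 0 < c) (hα : 0 < α) (hγ : 0 ≤ γ) :
    ∃ M, ∀ τ : 𝔼, (cauchyKer τ)⁻¹ * Real.exp (-(c * ‖τ‖ ^ (α + γ))) ≤ M := by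
  obtain ⟨r₀, hr₀⟩ := eventually_atTop.1
    ((tendsto_one_add_sq_pow_mul_exp_neg hc (add_pos_of_pos_of_nonneg hα hγ) n).eventually_le_const
      one_pos)
  refine ⟨(1 + r₀ ^ 2) ^ n + 1, fun τ => ?_⟩
  have h0 : (cauchyKer τ)⁻¹ * Real.exp (-(c * ‖τ‖ ^ (α + γ)))
      ≤ (1 + ‖τ‖ ^ 2) ^ n * Real.exp (-(c * ‖τ‖ ^ (α + γ))) :=
    mul_le_mul_of_nonneg_right (inv_cauchyKer_le τ) (Real.exp_pos _).le
  refine h0.trans ?_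
  rcases le_total ‖τ‖ r₀ with h | h
  · have h1 : Real.exp (-(c * ‖τ‖ ^ (α + γ))) ≤ 1 := by
      rw [Real.exp_le_one_iff]
      have : 0 ≤ c * ‖τ‖ ^ (α + γ) := by positivity
      linarith
    calc (1 + ‖τ‖ ^ 2) ^ n * Real.exp (-(c * ‖τ‖ ^ (α + γ))) ≤ (1 + r₀ ^ 2) ^ n * 1 := by gcongr
      _ ≤ _ := by linarith
  · have := hr₀ ‖τ‖ h
    have h2 : 0 ≤ (1 + r₀ ^ 2) ^ n := by positivity
    linarith

lemma exists_boundedContinuous_symbol (hc : 0 < c) (hα : 0 < α) (hγ : 0 ≤ γ) (v : 𝔼) :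
    ∃ g : BoundedContinuousFunction 𝔼 ℂ,
      (∀ τ, cauchyKer τ * g τ = Complex.exp (Complex.I * ((⟪v, τ⟫ : ℝ) : ℂ)) *
        (Real.exp (-(c * ‖τ‖ ^ (α + γ))) : ℝ)) ∧
      ∀ e > 0, ∀ᶠ δ in 𝓝 (0 : ℝ), ∀ τ,
        ‖Complex.exp (Complex.I * ((⟪v, τ⟫ : ℝ) : ℂ)) *
            (Real.exp (-(c * ‖τ‖ ^ α * (δ ^ 2 + ‖τ‖ ^ 2) ^ (γ / 2))) : ℝ) - cauchyKer τ * g τ‖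
          ≤ e * cauchyKer τ := by
  obtain ⟨M, hM⟩ := exists_inv_cauchyKer_mul_exp_le (n := n) hc hα hγ
  have hE : Continuous fun τ : 𝔼 => Real.exp (-(c * ‖τ‖ ^ (α + γ))) := by
    have : Continuous fun τ : 𝔼 => ‖τ‖ ^ (α + γ) :=
      Continuous.rpow_const (by fun_prop) fun _ => Or.inr (by positivity)
    fun_prop
  have hexp : ∀ τ : 𝔼, ‖Complex.exp (Complex.I * ((⟪v, τ⟫ : ℝ) : ℂ))‖ = 1 := fun τ => by
    rw [mul_comm, Complex.norm_exp_ofReal_mul_I]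
  have hcont : Continuous fun τ : 𝔼 => Complex.exp (Complex.I * ((⟪v, τ⟫ : ℝ) : ℂ)) *
      (((cauchyKer τ)⁻¹ * Real.exp (-(c * ‖τ‖ ^ (α + γ))) : ℝ) : ℂ) := by
    refine Continuous.mul (by fun_prop) (Complex.continuous_ofReal.comp ?_)
    exact (continuous_cauchyKer.inv₀ fun τ => (cauchyKer_pos τ).ne').mul hE
  have hprod : ∀ τ : 𝔼, (cauchyKer τ : ℂ) * (Complex.exp (Complex.I * ((⟪v, τ⟫ : ℝ) : ℂ)) *
      (((cauchyKer τ)⁻¹ * Real.exp (-(c * ‖τ‖ ^ (α + γ))) : ℝ) : ℂ))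
      = Complex.exp (Complex.I * ((⟪v, τ⟫ : ℝ) : ℂ)) *
        (Real.exp (-(c * ‖τ‖ ^ (α + γ))) : ℝ) := by
    intro τ
    have : (cauchyKer τ : ℂ) ≠ 0 := Complex.ofReal_ne_zero.2 (cauchyKer_pos τ).ne'
    push_cast
    field_simp
  refine ⟨BoundedContinuousFunction.ofNormedAddCommGroup _ hcont M fun τ => ?_, hprod,
    fun e he => ?_⟩
  · rw [norm_mul, hexp, one_mul, Complex.norm_real, Real.norm_eq_abs, abs_of_nonneg]
    · exact hM τ
    · exact mul_nonneg (inv_nonneg.2 (cauchyKer_pos τ).le) (Real.exp_pos _).le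
  · filter_upwards [eventually_abs_symbol_sub_le (n := n) hc hα hγ he] with δ hδ τ
    simp only [BoundedContinuousFunction.coe_ofNormedAddCommGroup]
    rw [hprod, ← mul_sub, norm_mul, hexp, one_mul, ← Complex.ofReal_sub, Complex.norm_real]
    exact hδ τ

end Symbol

/-! ### Covariance of smoothed subordinated fields -/

lemma integral_smoothing {Ω X : Type*} [MeasurableSpace Ω] [MeasurableSpace X] {P : Measure Ω}
    {ν : Measure X} [SFinite P] [SFinite ν] {φ : X → ℝ} (hφ : Integrable φ ν) {W : X → Ω → ℝ}
    (hW : Measurable (Function.uncurry W)) (hWi : ∀ x, Integrable (W x) P) {K : ℝ}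
    (hWK : ∀ x, ∫ ω, |W x ω| ∂P ≤ K) :
    Integrable (fun ω => ∫ x, φ x * W x ω ∂ν) P ∧
      ∫ ω, ∫ x, φ x * W x ω ∂ν ∂P = ∫ x, φ x * ∫ ω, W x ω ∂P ∂ν := by
  have hm : AEStronglyMeasurable (Function.uncurry fun x ω => φ x * W x ω) (ν.prod P) :=
    hφ.aestronglyMeasurable.comp_fst.mul hW.aestronglyMeasurable
  have hi : Integrable (Function.uncurry fun x ω => φ x * W x ω) (ν.prod P) := by
    rw [integrable_prod_iff hm]
    refine ⟨ae_of_all _ fun x => (hWi x).const_mul (φ x), ?_⟩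
    refine (hφ.abs.mul_const K).mono' hm.norm.integral_prod_right' (ae_of_all _ fun x => ?_)
    simp only [Function.uncurry, norm_mul, Real.norm_eq_abs, integral_const_mul, abs_abs]
    rw [abs_of_nonneg (integral_nonneg fun ω => abs_nonneg (W x ω))]
    exact mul_le_mul_of_nonneg_left (hWK x) (abs_nonneg _)
  refine ⟨hi.integral_prod_right, ?_⟩
  rw [← integral_integral_swap hi]
  simp_rw [integral_const_mul]

lemma integral_sub_mul_sub {Ω : Type*} [MeasurableSpace Ω] {P : Measure Ω} [IsProbabilityMeasure P]
    {A A' : Ω → ℝ} {c : ℝ} (hA : Integrable A P) (hA' : Integrable A' P)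
    (hAA : Integrable (fun ω => A ω * A' ω) P) (hc : ∫ ω, A ω ∂P = c) (hc' : ∫ ω, A' ω ∂P = c) :
    ∫ ω, (A ω - c) * (A' ω - c) ∂P = (∫ ω, A ω * A' ω ∂P) - c ^ 2 := by
  have h : ∀ ω, (A ω - c) * (A' ω - c) = A ω * A' ω - (c * A' ω + (c * A ω - c ^ 2)) := fun ω => by
    ring
  have h1 : Integrable (fun ω => c * A ω - c ^ 2) P := (hA.const_mul c).sub (integrable_const _)
  have h2 : Integrable (fun ω => c * A' ω + (c * A ω - c ^ 2)) P := (hA'.const_mul c).add h1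
  simp_rw [h]
  rw [integral_sub hAA h2, integral_add (hA'.const_mul c) h1,
    integral_sub (hA.const_mul c) (integrable_const _), integral_const_mul, integral_const_mul,
    hc, hc', integral_const, probReal_univ, one_smul]
  ring

lemma hasSum_tail {C : ℕ → ℝ} {r S : ℝ} (h : HasSum (fun σ => C σ ^ 2 * r ^ σ) S) :
    HasSum (fun σ => (if σ = 0 then 0 else C σ ^ 2) * r ^ σ) (S - C 0 ^ 2) := by
  have h1 := h.sub (hasSum_ite_eq 0 (C 0 ^ 2))
  refine h1.congr_fun fun σ => ?_
  by_cases hσ : σ = 0 <;> simp [hσ]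

section Smoothing

variable {n : ℕ}

local notation "𝔼" => EuclideanSpace ℝ (Fin n)

lemma covariance_smoothing {Ω : Type*} [MeasurableSpace Ω] {P : Measure Ω} [IsProbabilityMeasure P]
    {ζ : 𝔼 → Ω → ℝ} (hζ : Measurable (Function.uncurry ζ)) {R : 𝔼 → ℝ}
    (hpair : ∀ x y, IsStdGaussianPair P (ζ x) (ζ y) (R (x - y))) {h : ℝ → ℝ} (hhm : Measurable h)
    (hh : MemLp h 2 (gaussianReal 0 1)) {C : ℕ → ℝ}
    (hC : ∀ σ, C σ = ∫ u, h u * (hermiteFun σ u / Real.sqrt σ.factorial) ∂gaussianReal 0 1)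
    {φ φ' : 𝔼 → ℝ} (hφ : Integrable φ) (hφ' : Integrable φ') (hφ1 : ∫ y, φ y = 1)
    (hφ1' : ∫ y, φ' y = 1) {p p' : 𝔼 → 𝔼} (hp : Measurable p) (hp' : Measurable p') (s : ℝ)
    {U U' : Ω → ℝ} (hU : ∀ ω, U ω = s * ((∫ y, φ y * h (ζ (p y) ω)) - C 0))
    (hU' : ∀ ω, U' ω = s * ((∫ y, φ' y * h (ζ (p' y) ω)) - C 0)) :
    (∫ ω, U ω * U' ω ∂P) - (∫ ω, U ω ∂P) * (∫ ω, U' ω ∂P)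
      = s ^ 2 * ∫ q : 𝔼 × 𝔼, φ q.1 * φ' q.2 *
        ∑' σ, (if σ = 0 then 0 else C σ ^ 2) * R (p q.1 - p' q.2) ^ σ := by
  have hmp : ∀ x, MeasurePreserving (ζ x) P (gaussianReal 0 1) := fun x =>
    (hpair x x).measurePreserving_left
  have hL2 : ∀ x, MemLp (fun ω => h (ζ x ω)) 2 P := fun x => hh.comp_measurePreserving (hmp x)
  set H := ∫ u, h u ^ 2 ∂gaussianReal 0 1 with hH
  have hsq : ∀ x, ∫ ω, h (ζ x ω) ^ 2 ∂P = H := by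
    intro x
    rw [hH, ← (hmp x).map_eq, integral_map (hmp x).measurable.aemeasurable
      (hhm.pow_const 2).aestronglyMeasurable]
  have hmean : ∀ x, ∫ ω, h (ζ x ω) ∂P = C 0 := by
    intro x
    rw [hC 0, ← (hmp x).map_eq, integral_map (hmp x).measurable.aemeasurable
      (by simpa [hermiteFun] using hhm.aestronglyMeasurable)]
    simp [hermiteFun]
  have hprod : ∀ x y, Integrable (fun ω => h (ζ x ω) * h (ζ y ω)) P := fun x y =>
    (hL2 x).integrable_mul (hL2 y)
  have hVm : ∀ {X : Type} [MeasurableSpace X] {k : X → 𝔼}, Measurable k →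
      Measurable (Function.uncurry fun y ω => h (ζ (k y) ω)) := fun hk =>
    hhm.comp (hζ.comp ((hk.comp measurable_fst).prodMk measurable_snd))
  have hbound : ∀ x, ∫ ω, |h (ζ x ω)| ∂P ≤ 1 + H := by
    intro x
    rw [← hsq x, show (1 : ℝ) = ∫ _, (1 : ℝ) ∂P by simp,
      ← integral_add (integrable_const _) (hL2 x).integrable_sq]
    refine integral_mono ((hL2 x).integrable one_le_two).abs
      ((integrable_const _).add (hL2 x).integrable_sq) fun ω => ?_
    rw [abs_le]
    constructor <;> nlinarith [sq_nonneg (h (ζ x ω) - 1), sq_nonneg (h (ζ x ω) + 1)]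
  have hbound2 : ∀ x y, ∫ ω, |h (ζ x ω) * h (ζ y ω)| ∂P ≤ H := by
    intro x y
    have hH2 : H = ∫ ω, (2⁻¹ * h (ζ x ω) ^ 2 + 2⁻¹ * h (ζ y ω) ^ 2) ∂P := by
      rw [integral_add ((hL2 x).integrable_sq.const_mul _) ((hL2 y).integrable_sq.const_mul _),
        integral_const_mul, integral_const_mul, hsq, hsq]
      ring
    rw [hH2]
    refine integral_mono (hprod x y).abs
      (((hL2 x).integrable_sq.const_mul _).add ((hL2 y).integrable_sq.const_mul _)) fun ω => ?_
    rw [abs_le]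
    constructor <;> nlinarith [sq_nonneg (h (ζ x ω) - h (ζ y ω)),
      sq_nonneg (h (ζ x ω) + h (ζ y ω))]
  have hone : ∀ {k : 𝔼 → 𝔼} (_ : Measurable k) {ψ : 𝔼 → ℝ} (_ : Integrable ψ) (_ : ∫ y, ψ y = 1),
      Integrable (fun ω => ∫ y, ψ y * h (ζ (k y) ω)) P ∧
        ∫ ω, (∫ y, ψ y * h (ζ (k y) ω)) ∂P = C 0 := by
    intro k hk ψ hψ hψ1
    obtain ⟨h1, h2⟩ := integral_smoothing hψ (hVm hk)
      (fun y => (hL2 (k y)).integrable one_le_two) fun y => hbound (k y)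
    refine ⟨h1, h2.trans ?_⟩
    simp_rw [hmean, integral_mul_const, hψ1, one_mul]
  obtain ⟨hi, hE⟩ := hone hp hφ hφ1
  obtain ⟨hi', hE'⟩ := hone hp' hφ' hφ1'
  have hφφ : Integrable (fun q : 𝔼 × 𝔼 => φ q.1 * φ' q.2) := hφ.mul_prod hφ'
  have hφφ1 : ∫ q : 𝔼 × 𝔼, φ q.1 * φ' q.2 = 1 := by
    rw [Measure.volume_eq_prod, integral_prod_mul, hφ1, hφ1', one_mul]
  have hW : Measurable (Function.uncurry fun (q : 𝔼 × 𝔼) ω =>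
      h (ζ (p q.1) ω) * h (ζ (p' q.2) ω)) :=
    (hVm (hp.comp measurable_fst)).mul (hVm (hp'.comp measurable_snd))
  obtain ⟨hii, hEE⟩ := integral_smoothing (P := P) hφφ hW
    (fun q => hprod _ _) fun q => hbound2 _ _
  have hmul : ∀ ω, ∫ q : 𝔼 × 𝔼, φ q.1 * φ' q.2 * (h (ζ (p q.1) ω) * h (ζ (p' q.2) ω))
      = (∫ y, φ y * h (ζ (p y) ω)) * ∫ y, φ' y * h (ζ (p' y) ω) := by
    intro ω
    rw [Measure.volume_eq_prod, ← integral_prod_mul]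
    refine integral_congr_ae (ae_of_all _ fun q => ?_)
    simp only
    ring
  simp_rw [hmul] at hii hEE
  have hmeh : ∀ q : 𝔼 × 𝔼, ∑' σ, (if σ = 0 then 0 else C σ ^ 2) * R (p q.1 - p' q.2) ^ σ
      = (∫ ω, h (ζ (p q.1) ω) * h (ζ (p' q.2) ω) ∂P) - C 0 ^ 2 := fun q =>
    (hasSum_tail ((hpair (p q.1) (p' q.2)).hasSum_mehler hh hC)).tsum_eq
  have hcorr : Integrable (fun q : 𝔼 × 𝔼 =>
      φ q.1 * φ' q.2 * ∫ ω, h (ζ (p q.1) ω) * h (ζ (p' q.2) ω) ∂P) := by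
    refine (hφφ.norm.mul_const H).mono' (hφφ.aestronglyMeasurable.mul ?_)
      (ae_of_all _ fun q => ?_)
    · exact (hW.stronglyMeasurable.integral_prod_right (ν := P)).aestronglyMeasurable
    · rw [norm_mul]
      refine mul_le_mul_of_nonneg_left ?_ (norm_nonneg _)
      exact (norm_integral_le_integral_norm _).trans (hbound2 _ _)
  simp_rw [hmeh, mul_sub]
  rw [integral_sub hcorr (hφφ.mul_const _), integral_mul_const, hφφ1, ← hEE, one_mul]
  have hU0 : ∫ ω, U ω ∂P = 0 := by
    simp_rw [hU]
    rw [integral_const_mul, integral_sub hi (integrable_const _), hE]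
    simp
  rw [hU0, zero_mul, sub_zero]
  have hUU : ∀ ω, U ω * U' ω = s ^ 2 * (((∫ y, φ y * h (ζ (p y) ω)) - C 0) *
      ((∫ y, φ' y * h (ζ (p' y) ω)) - C 0)) := by
    intro ω
    rw [hU, hU']
    ring
  simp_rw [hUU]
  rw [integral_const_mul, integral_sub_mul_sub hi hi' hii hE hE']

/-- Plancherel-type identity for smoothing a positive definite kernel. -/
lemma integral_mul_charFun (ν : Measure 𝔼) [IsFiniteMeasure ν] {φ φ' : 𝔼 → ℝ} (hφ : Integrable φ)
    (hφ' : Integrable φ') (v : 𝔼) (r : ℝ) :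
    ∫ q : 𝔼 × 𝔼, ((φ q.1 * φ' q.2 : ℝ) : ℂ) * charFun ν (v - r • (q.1 - q.2))
      = ∫ τ, Complex.exp (Complex.I * ((⟪v, τ⟫ : ℝ) : ℂ)) *
        ((∫ y, Complex.exp (Complex.I * ((⟪y, -(r • τ)⟫ : ℝ) : ℂ)) * φ y) *
          ∫ y, Complex.exp (Complex.I * ((⟪y, r • τ⟫ : ℝ) : ℂ)) * φ' y) ∂ν := by
  have h0 : ∀ q : 𝔼 × 𝔼, ((φ q.1 * φ' q.2 : ℝ) : ℂ) * charFun ν (v - r • (q.1 - q.2))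
      = ∫ τ, ((φ q.1 * φ' q.2 : ℝ) : ℂ) *
        Complex.exp (⟪τ, v - r • (q.1 - q.2)⟫ * Complex.I) ∂ν := fun q => by
    rw [charFun_apply, ← integral_const_mul]
  simp_rw [h0]
  rw [integral_integral_swap]
  · refine integral_congr_ae (ae_of_all _ fun τ => ?_)
    simp only
    rw [← integral_prod_mul, ← integral_const_mul, Measure.volume_eq_prod]
    refine integral_congr_ae (ae_of_all _ fun q => ?_)
    simp only
    have e1 : ((⟪τ, v - r • (q.1 - q.2)⟫ : ℝ) : ℂ) * Complex.I
        = Complex.I * ((⟪v, τ⟫ : ℝ) : ℂ) + (Complex.I * ((⟪q.1, -(r • τ)⟫ : ℝ) : ℂ)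
          + Complex.I * ((⟪q.2, r • τ⟫ : ℝ) : ℂ)) := by
      rw [inner_sub_right, inner_smul_right, inner_sub_right, inner_neg_right, inner_smul_right,
        inner_smul_right, real_inner_comm v τ, real_inner_comm q.1 τ, real_inner_comm q.2 τ]
      push_cast
      ring
    rw [e1, Complex.exp_add, Complex.exp_add]
    push_cast
    ring
  · have hφφ : Integrable (fun q : 𝔼 × 𝔼 => ((φ q.1 * φ' q.2 : ℝ) : ℂ)) :=
      (hφ.mul_prod hφ').ofReal
    have h1 := hφφ.mul_prod (integrable_const (μ := ν) (1 : ℂ))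
    refine h1.mono ?_ (ae_of_all _ fun q => ?_)
    · exact hφφ.aestronglyMeasurable.comp_fst.mul (Continuous.aestronglyMeasurable (by fun_prop))
    · simp only [Function.uncurry, norm_mul, Complex.norm_exp_ofReal_mul_I, norm_one, le_refl]

end Smoothing

/-! ### Micro-scaling of the covariance -/

lemma abs_tsum_mul_pow_le {c : ℕ → ℝ} (hc0 : ∀ σ, 0 ≤ c σ) (hs : Summable c) {m : ℕ}
    (hcm : ∀ σ < m, c σ = 0) {r : ℝ} (hr : |r| ≤ 1) :
    |∑' σ, c σ * r ^ σ| ≤ (∑' σ, c σ) * |r| ^ m := by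
  rw [← tsum_mul_right, ← Real.norm_eq_abs]
  refine tsum_of_norm_bounded (hs.mul_right _).hasSum fun σ => ?_
  rw [norm_mul, norm_pow, Real.norm_eq_abs, Real.norm_eq_abs, abs_of_nonneg (hc0 σ)]
  rcases lt_or_ge σ m with h | h
  · simp [hcm σ h]
  · exact mul_le_mul_of_nonneg_left (pow_le_pow_of_le_one (abs_nonneg r) hr h) (hc0 σ)

lemma abs_tsum_mul_pow_sub_le {c : ℕ → ℝ} (hc0 : ∀ σ, 0 ≤ c σ) (hs : Summable c) {m : ℕ}
    (hcm : ∀ σ < m, c σ = 0) {r : ℝ} (hr : |r| ≤ 1) :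
    |∑' σ, c σ * r ^ σ - c m * r ^ m| ≤ (∑' σ, c σ) * |r| ^ (m + 1) := by
  have hsr : Summable fun σ => c σ * r ^ σ := by
    refine Summable.of_norm_bounded hs fun σ => ?_
    rw [norm_mul, norm_pow, Real.norm_eq_abs, Real.norm_eq_abs, abs_of_nonneg (hc0 σ)]
    exact mul_le_of_le_one_right (hc0 σ) (pow_le_one₀ (abs_nonneg r) hr)
  set d : ℕ → ℝ := fun σ => if σ = m then 0 else c σ with hd
  have hd0 : ∀ σ, 0 ≤ d σ := fun σ => by
    by_cases h : σ = m <;> simp [hd, h, hc0]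
  have hdc : ∀ σ, d σ ≤ c σ := fun σ => by
    by_cases h : σ = m <;> simp [hd, h, hc0]
  have hds : Summable d := Summable.of_nonneg_of_le hd0 hdc hs
  have hdm : ∀ σ < m + 1, d σ = 0 := fun σ h => by
    rcases (Nat.lt_succ_iff.1 h).eq_or_lt with h | h
    · simp [hd, h]
    · simp [hd, hcm σ h]
  have e1 : ∑' σ, c σ * r ^ σ - c m * r ^ m = ∑' σ, d σ * r ^ σ := by
    rw [hsr.tsum_eq_add_tsum_ite m, add_sub_cancel_left]
    refine tsum_congr fun σ => ?_
    by_cases h : σ = m <;> simp [hd, h]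
  rw [e1]
  exact (abs_tsum_mul_pow_le hd0 hds hdm hr).trans
    (mul_le_mul_of_nonneg_right (hds.tsum_le_tsum hdc hs) (by positivity))

/-- The symbol is invariant, up to a vanishing Bessel regularization, under micro-scaling. -/
lemma scaled_symbol_eq {ε α γ : ℝ} (hε : 0 < ε) (hα : 0 < α) (hγ : 0 ≤ γ) {s : ℝ} (hs : 0 ≤ s) :
    ε * ((ε ^ (-(1 / (α + γ))) * s) ^ α * (1 + (ε ^ (-(1 / (α + γ))) * s) ^ 2) ^ (γ / 2))
      = s ^ α * ((ε ^ (1 / (α + γ))) ^ 2 + s ^ 2) ^ (γ / 2) := by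
  set δ := ε ^ (1 / (α + γ)) with hδ
  have hδ0 : 0 < δ := Real.rpow_pos_of_pos hε _
  have h1 : ε ^ (-(1 / (α + γ))) = δ⁻¹ := Real.rpow_neg hε.le _
  have h2 : ε = δ ^ α * δ ^ γ := by
    rw [← Real.rpow_add hδ0, hδ, ← Real.rpow_mul hε.le, one_div_mul_cancel (by positivity),
      Real.rpow_one]
  have h3 : 1 + (δ⁻¹ * s) ^ 2 = (δ⁻¹) ^ 2 * (δ ^ 2 + s ^ 2) := by
    field_simp
  have h4 : ((δ⁻¹) ^ 2) ^ (γ / 2) = (δ ^ γ)⁻¹ := by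
    rw [← Real.inv_rpow hδ0.le, ← Real.rpow_natCast, ← Real.rpow_mul (by positivity)]
    congr 1
    push_cast
    ring
  rw [h1, h3, Real.mul_rpow (by positivity) hs, Real.mul_rpow (by positivity) (by positivity), h4,
    Real.inv_rpow hδ0.le]
  nth_rewrite 1 [h2]
  have := Real.rpow_pos_of_pos hδ0 α
  have := Real.rpow_pos_of_pos hδ0 γ
  field_simp

lemma integral_eq_one_of_fourier {n : ℕ} {μ s α γ : ℝ} (hα : 0 < α)
    {φ : EuclideanSpace ℝ (Fin n) → ℝ}
    (h : ∀ l : EuclideanSpace ℝ (Fin n),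
      ∫ y, Complex.exp (Complex.I * ((⟪y, l⟫ : ℝ) : ℂ)) * φ y
        = (Real.exp (-(μ * s * ‖l‖ ^ α * (1 + ‖l‖ ^ 2) ^ (γ / 2))) : ℝ)) :
    ∫ y, φ y = 1 := by
  have h0 := h 0
  simp only [inner_zero_right, Complex.ofReal_zero, mul_zero, Complex.exp_zero, one_mul, norm_zero,
    Real.zero_rpow hα.ne', zero_mul, neg_zero, Real.exp_zero] at h0
  rw [integral_complex_ofReal] at h0
  exact_mod_cast h0

lemma isStdGaussianPair_of_field {E Ω : Type*} [MeasurableSpace E] [Sub E] [MeasurableSpace Ω]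
    {P : Measure Ω} {ζ : E → Ω → ℝ} (hζ : Measurable fun q : E × Ω => ζ q.1 q.2)
    (hG : ∀ (k : ℕ) (pts : Fin k → E) (c : Fin k → ℝ),
      ∃ v : NNReal, Measure.map (fun ω => ∑ i, c i * ζ (pts i) ω) P = gaussianReal 0 v)
    {R : E → ℝ} (hvar : ∀ x, ∫ ω, ζ x ω ^ 2 ∂P = 1)
    (hcov : ∀ x y, ∫ ω, ζ x ω * ζ y ω ∂P = R (x - y)) (x y : E) :
    IsStdGaussianPair P (ζ x) (ζ y) (R (x - y)) where
  measurable_left := hζ.comp measurable_prodMk_left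
  measurable_right := hζ.comp measurable_prodMk_left
  gaussian a b := by
    obtain ⟨v, hv⟩ := hG 2 ![x, y] ![a, b]
    exact ⟨v, by simpa [Fin.sum_univ_two] using hv⟩
  sq_left := hvar x
  sq_right := hvar y
  cov := hcov x y

section MicroScaling

variable {n : ℕ}

local notation "𝔼" => EuclideanSpace ℝ (Fin n)

lemma micro_scaling_sub {ε : ℝ} (hε : 0 < ε) (q χ : ℝ) (x x' y y' : 𝔼) :
    (ε ^ (-q - χ)) • ((ε ^ q) • x - y) - (ε ^ (-q - χ)) • ((ε ^ q) • x' - y')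
      = (ε ^ (-χ)) • ((x - x') - (ε ^ (-q)) • (y - y')) := by
  have h1 : ε ^ (-q - χ) = ε ^ (-χ) * ε ^ (-q) := by
    rw [← Real.rpow_add hε]; ring_nf
  have h2 : ε ^ (-q) * ε ^ q = 1 := by
    rw [← Real.rpow_add hε]; simp
  have h3 : ε ^ (-q - χ) * ε ^ q = ε ^ (-χ) := by
    rw [h1, mul_assoc, h2, mul_one]
  simp only [smul_sub, smul_smul, h3, ← h1]
  abel

lemma fourier_product_eq_symbol {ε μ α γ : ℝ} (hε : 0 < ε) (hα : 0 < α) (hγ : 0 ≤ γ)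
    (t t' : ℝ) {φ φ' : 𝔼 → ℝ}
    (hφ : ∀ l : 𝔼, ∫ y, Complex.exp (Complex.I * ((⟪y, l⟫ : ℝ) : ℂ)) * φ y
      = (Real.exp (-(μ * (ε * t) * ‖l‖ ^ α * (1 + ‖l‖ ^ 2) ^ (γ / 2))) : ℝ))
    (hφ' : ∀ l : 𝔼, ∫ y, Complex.exp (Complex.I * ((⟪y, l⟫ : ℝ) : ℂ)) * φ' y
      = (Real.exp (-(μ * (ε * t') * ‖l‖ ^ α * (1 + ‖l‖ ^ 2) ^ (γ / 2))) : ℝ)) (τ : 𝔼) :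
    (∫ y, Complex.exp (Complex.I * ((⟪y, -((ε ^ (-(1 / (α + γ)))) • τ)⟫ : ℝ) : ℂ)) * φ y) *
        ∫ y, Complex.exp (Complex.I * ((⟪y, (ε ^ (-(1 / (α + γ)))) • τ⟫ : ℝ) : ℂ)) * φ' y
      = (Real.exp (-(μ * (t + t') * ‖τ‖ ^ α *
          ((ε ^ (1 / (α + γ))) ^ 2 + ‖τ‖ ^ 2) ^ (γ / 2))) : ℝ) := by
  rw [hφ, hφ', ← Complex.ofReal_mul, ← Real.exp_add, norm_neg, norm_smul, Real.norm_eq_abs,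
    abs_of_pos (Real.rpow_pos_of_pos hε _)]
  congr 2
  have := scaled_symbol_eq hε hα hγ (norm_nonneg τ)
  linear_combination (-(μ * (t + t'))) * this

lemma covariance_eq_integral_spectral {Ω : Type*} [MeasurableSpace Ω] {P : Measure Ω}
    [IsProbabilityMeasure P] {ζ : 𝔼 → Ω → ℝ} (hζ : Measurable (Function.uncurry ζ)) {R : 𝔼 → ℝ}
    (hpair : ∀ x y, IsStdGaussianPair P (ζ x) (ζ y) (R (x - y))) {h : ℝ → ℝ} (hhm : Measurable h)
    (hh : MemLp h 2 (gaussianReal 0 1)) {C : ℕ → ℝ}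
    (hC : ∀ σ, C σ = ∫ u, h u * (hermiteFun σ u / Real.sqrt σ.factorial) ∂gaussianReal 0 1)
    {ε μ α γ χ A t t' : ℝ} (hε : 0 < ε) (hα : 0 < α) (hγ : 0 ≤ γ) (hA : 0 < A) {φ φ' : 𝔼 → ℝ}
    (hφi : Integrable φ) (hφi' : Integrable φ')
    (hφ : ∀ l : 𝔼, ∫ y, Complex.exp (Complex.I * ((⟪y, l⟫ : ℝ) : ℂ)) * φ y
      = (Real.exp (-(μ * (ε * t) * ‖l‖ ^ α * (1 + ‖l‖ ^ 2) ^ (γ / 2))) : ℝ))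
    (hφ' : ∀ l : 𝔼, ∫ y, Complex.exp (Complex.I * ((⟪y, l⟫ : ℝ) : ℂ)) * φ' y
      = (Real.exp (-(μ * (ε * t') * ‖l‖ ^ α * (1 + ‖l‖ ^ 2) ^ (γ / 2))) : ℝ))
    (x x' : 𝔼) {U U' : Ω → ℝ}
    (hU : ∀ ω, U ω = A ^ (-(1 / 2) : ℝ) * ((∫ y, φ y * h (ζ ((ε ^ (-(1 / (α + γ)) - χ)) •
      ((ε ^ (1 / (α + γ))) • x - y)) ω)) - C 0))
    (hU' : ∀ ω, U' ω = A ^ (-(1 / 2) : ℝ) * ((∫ y, φ' y * h (ζ ((ε ^ (-(1 / (α + γ)) - χ)) •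
      ((ε ^ (1 / (α + γ))) • x' - y)) ω)) - C 0))
    {ν : Measure 𝔼} [IsFiniteMeasure ν]
    (hν : ∀ z, charFun ν z
      = ((∑' σ, (if σ = 0 then 0 else C σ ^ 2) * R ((ε ^ (-χ)) • z) ^ σ) / A : ℝ)) :
    (((∫ ω, U ω * U' ω ∂P) - (∫ ω, U ω ∂P) * (∫ ω, U' ω ∂P) : ℝ) : ℂ)
      = ∫ τ, Complex.exp (Complex.I * ((⟪x - x', τ⟫ : ℝ) : ℂ)) *
        (Real.exp (-(μ * (t + t') * ‖τ‖ ^ α *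
          ((ε ^ (1 / (α + γ))) ^ 2 + ‖τ‖ ^ 2) ^ (γ / 2))) : ℝ) ∂ν := by
  have hs : (A ^ (-(1 / 2) : ℝ)) ^ 2 = A⁻¹ := by
    rw [← Real.rpow_natCast, ← Real.rpow_mul hA.le]
    norm_num [Real.rpow_neg_one]
  rw [covariance_smoothing hζ hpair hhm hh hC hφi hφi' (integral_eq_one_of_fourier hα hφ)
    (integral_eq_one_of_fourier hα hφ')
    (p := fun y => (ε ^ (-(1 / (α + γ)) - χ)) • ((ε ^ (1 / (α + γ))) • x - y))
    (p' := fun y => (ε ^ (-(1 / (α + γ)) - χ)) • ((ε ^ (1 / (α + γ))) • x' - y))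
    (by fun_prop) (by fun_prop) _ hU hU', hs, ← integral_const_mul, ← integral_complex_ofReal]
  simp_rw [← fourier_product_eq_symbol hε hα hγ t t' hφ hφ']
  rw [← integral_mul_charFun ν hφi hφi']
  refine integral_congr_ae (.of_forall fun q => ?_)
  simp only [hν, micro_scaling_sub hε]
  push_cast
  ring

lemma tendsto_covariance_of_seq (hn : 1 ≤ n) {μ α γ χ : ℝ} (hμ : 0 < μ) (hα : 0 < α) (hγ : 0 ≤ γ)
    (hχ : 0 < χ) {R : 𝔼 → ℝ} (hR1 : ∀ z, |R z| ≤ 1)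
    {p : Measure 𝔼} [IsProbabilityMeasure p] (hp : ∀ z, charFun p z = R z)
    {c : ℕ → ℝ} (hc0 : ∀ σ, 0 ≤ c σ) (hc : Summable c) {m : ℕ}
    (hcm : ∀ σ < m, c σ = 0) (hcm0 : 0 < c m) (hm : 1 ≤ m) {κ : ℝ} (hκ0 : 0 < κ) (hκn : (m : ℝ) * κ < n)
    {L : ℝ → ℝ} (hLpos : ∀ y > 0, 0 < L y) (hL : SlowlyVaryingAtTop L)
    (hR : Tendsto (fun z : 𝔼 => R z * ‖z‖ ^ κ / L ‖z‖) (comap norm atTop) (𝓝 1))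
    {t : ℝ} (ht : 0 < t) (v : 𝔼) {u : ℕ → ℝ} (hu0 : ∀ k, 0 < u k) (hu : Tendsto u atTop (𝓝 0)) :
    ∃ ν : ℕ → Measure 𝔼, (∀ k, IsFiniteMeasure (ν k)) ∧
      (∀ k z, charFun (ν k) z = ((∑' σ, c σ * R ((u k ^ (-χ)) • z) ^ σ) /
        (u k ^ (m * κ * χ) * L (u k ^ (-χ)) ^ m) : ℝ)) ∧
      Tendsto (fun k => ∫ τ, Complex.exp (Complex.I * ((⟪v, τ⟫ : ℝ) : ℂ)) *
        (Real.exp (-(μ * t * ‖τ‖ ^ α *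
          ((u k ^ (1 / (α + γ))) ^ 2 + ‖τ‖ ^ 2) ^ (γ / 2))) : ℝ) ∂ν k) atTop
        (𝓝 (((c m * tauberK n (m * κ) : ℝ) : ℂ) *
          ∫ τ : 𝔼, Complex.exp (Complex.I * ((⟪v, τ⟫ : ℝ) : ℂ)) *
            ((Real.exp (-(μ * t * ‖τ‖ ^ (α + γ))) * ‖τ‖ ^ (m * κ - n) : ℝ) : ℂ))) := by
  have hm0 : (0 : ℝ) < m := by exact_mod_cast hm
  have hy : Tendsto (fun k => u k ^ (-χ)) atTop atTop :=
    (tendsto_rpow_neg_nhdsGT_zero (neg_lt_zero.2 hχ)).comp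
      (tendsto_nhdsWithin_iff.2 ⟨hu, .of_forall hu0⟩)
  have hyp : ∀ k, 0 < u k ^ (-χ) := fun k => Real.rpow_pos_of_pos (hu0 k) _
  have hA : ∀ k, u k ^ (m * κ * χ) * L (u k ^ (-χ)) ^ m
      = ((u k ^ (-χ)) ^ (-κ) * L (u k ^ (-χ))) ^ m := fun k => by
    rw [mul_pow, ← Real.rpow_mul (hu0 k).le, ← Real.rpow_natCast (u k ^ (-χ * -κ)),
      ← Real.rpow_mul (hu0 k).le]
    ring_nf
  have hApos : ∀ k, 0 < u k ^ (m * κ * χ) * L (u k ^ (-χ)) ^ m := fun k =>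
    mul_pos (Real.rpow_pos_of_pos (hu0 k) _) (pow_pos (hLpos _ (hyp k)) _)
  obtain ⟨ν₀, hν₀, hν₀c⟩ := exists_charFun_eq_tsum p hc0 hc
  have hν : ∀ k, ∃ ν' : Measure 𝔼, IsFiniteMeasure ν' ∧
      ∀ z, charFun ν' z = ((∑' σ, c σ * R ((u k ^ (-χ)) • z) ^ σ) /
        (u k ^ (m * κ * χ) * L (u k ^ (-χ)) ^ m) : ℝ) := fun k => by
    obtain ⟨ν', h1, h2⟩ := exists_charFun_scaled ν₀ (inv_nonneg.2 (hApos k).le) (u k ^ (-χ))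
    refine ⟨ν', h1, fun z => ?_⟩
    rw [h2, hν₀c, div_eq_inv_mul, Complex.ofReal_mul, Complex.ofReal_tsum]
    simp [hp]
  choose ν hνf hνc using hν
  refine ⟨ν, hνf, hνc, ?_⟩
  obtain ⟨g, hg, hgF⟩ := exists_boundedContinuous_symbol (mul_pos hμ ht) hα hγ v
  obtain ⟨η, hη, hηκ, hηn⟩ : ∃ η > 0, η < κ ∧ (m : ℝ) * (κ + η) < n := by
    have hd : 0 < (n - m * κ) / m := div_pos (sub_pos.2 hκn) hm0
    refine ⟨min κ ((n - m * κ) / m) / 2, by positivity, ?_, ?_⟩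
    · linarith [min_le_left κ ((n - m * κ) / m)]
    · have h1 : min κ ((n - m * κ) / m) / 2 < (n - m * κ) / m := by
        linarith [min_le_right κ ((n - m * κ) / m)]
      have h2 := (lt_div_iff₀ hm0).1 h1
      linarith
  obtain ⟨D, -, Y, -, hD⟩ := scaled_covariance_le hLpos hL hR hR1 (tsum_nonneg hc0)
    (fun r hr => abs_tsum_mul_pow_le hc0 hc hcm hr) hη hηκ
  have hδ : Tendsto (fun k => u k ^ (1 / (α + γ))) atTop (𝓝 0) := by
    have hq : 0 < 1 / (α + γ) := by positivity
    have := hu.rpow_const (p := 1 / (α + γ)) (Or.inr hq.le)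
    rwa [Real.zero_rpow hq.ne'] at this
  have key := tendsto_integral_spectral hn (a := m * κ) (p := m * (κ + η)) (c := c m) (D := D)
    (by positivity) hκn (by positivity) hηn hcm0 (ν := ν) hνc
    (fun w hw => by
      simp_rw [hA]
      exact (tendsto_scaled_covariance hκ0 hLpos hL hR hR1
        (fun r hr => abs_tsum_mul_pow_sub_le hc0 hc hcm hr) hw).comp hy)
    (by
      filter_upwards [hy.eventually_ge_atTop Y] with k hk w hw
      rw [hA]
      exact hD _ hk w hw)
    (F := fun k τ => Complex.exp (Complex.I * ((⟪v, τ⟫ : ℝ) : ℂ)) *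
        (Real.exp (-(μ * t * ‖τ‖ ^ α *
          ((u k ^ (1 / (α + γ))) ^ 2 + ‖τ‖ ^ 2) ^ (γ / 2))) : ℝ))
    (fun k => by
      have := (continuous_exp_symbol (n := n) (μ * t) hα hγ).comp
        (Continuous.prodMk (continuous_const (y := u k ^ (1 / (α + γ)))) continuous_id)
      exact Continuous.mul (by fun_prop) (Complex.continuous_ofReal.comp this))
    g (fun e he => hδ.eventually (hgF e he))
  convert key using 2
  push_cast
  congr 1
  refine integral_congr_ae (.of_forall fun τ => ?_)
  simp only [hg]
  push_cast
  ring

end MicroScaling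

/-- Theorem 1, part (1) of the paper: the micro-scaling covariance limit for a
single fractional kinetic equation `∂_t s = −μ(I−Δ)^{γ/2}(−Δ)^{α/2}s` with
subordinated-Gaussian long-range-dependent initial data `s(0,x) = h(ζ(x))`. -/
theorem micro_scaling_covariance_limit
    (n : ℕ) (hn : 1 ≤ n) (μ α γ χ : ℝ)
    (hμ : 0 < μ) (hα : 0 < α) (hγ : 0 ≤ γ) (hχ : 0 < χ)
    {Ω : Type*} [MeasurableSpace Ω] {P : Measure Ω} [IsProbabilityMeasure P]
    (ζ : EuclideanSpace ℝ (Fin n) → Ω → ℝ)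
    (hζmeas : Measurable (fun pr : EuclideanSpace ℝ (Fin n) × Ω => ζ pr.1 pr.2))
    (hζGauss : ∀ (k : ℕ) (pts : Fin k → EuclideanSpace ℝ (Fin n)) (c : Fin k → ℝ),
      ∃ v : NNReal, Measure.map (fun ω => ∑ i, c i * ζ (pts i) ω) P = gaussianReal 0 v)
    (R : EuclideanSpace ℝ (Fin n) → ℝ)
    (hζvar : ∀ x, ∫ ω, (ζ x ω) ^ 2 ∂P = 1)
    (hζcov : ∀ x y, ∫ ω, ζ x ω * ζ y ω ∂P = R (x - y))
    (f : EuclideanSpace ℝ (Fin n) → ℝ)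
    (hfmeas : Measurable f) (hfnonneg : ∀ l, 0 ≤ f l) (hfint : Integrable f)
    (hfradial : ∀ l l' : EuclideanSpace ℝ (Fin n), ‖l‖ = ‖l'‖ → f l = f l')
    (lam0 : ℝ) (hlam0 : 0 < lam0)
    (hfdecr : ∀ l l' : EuclideanSpace ℝ (Fin n), lam0 < ‖l‖ → ‖l‖ ≤ ‖l'‖ → f l' ≤ f l)
    (hfcont : ∀ l : EuclideanSpace ℝ (Fin n), l ≠ 0 → ContinuousAt f l)
    (hRf : ∀ z, (↑(R z) : ℂ) = ∫ l, Complex.exp (Complex.I * ((⟪l, z⟫ : ℝ) : ℂ)) * ↑(f l))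
    (h : ℝ → ℝ) (hhmeas : Measurable h)
    (hhL2 : Integrable (fun u => (h u) ^ 2) (gaussianReal 0 1))
    (C : ℕ → ℝ)
    (hC : ∀ σ, C σ = ∫ u, h u * (hermiteFun σ u / Real.sqrt (σ.factorial))
      ∂(gaussianReal 0 1))
    (m : ℕ) (hm1 : 1 ≤ m) (hCm : C m ≠ 0) (hCσ : ∀ σ, 1 ≤ σ → σ < m → C σ = 0)
    (κ : ℝ) (hκ0 : 0 < κ) (hκn : (m : ℝ) * κ < n)
    (L : ℝ → ℝ) (hLpos : ∀ y > 0, 0 < L y) (hL : SlowlyVaryingAtTop L)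
    (hLbdd : ∀ M > 0, ∃ Cb, ∀ y ∈ Set.Ioc (0:ℝ) M, L y ≤ Cb)
    (hRasymp : Tendsto (fun z : EuclideanSpace ℝ (Fin n) => R z * ‖z‖ ^ κ / L ‖z‖)
      (Filter.comap norm Filter.atTop) (𝓝 1))
    (G : ℝ → EuclideanSpace ℝ (Fin n) → ℝ)
    (hGint : ∀ s > 0, Integrable (G s))
    (hGft : ∀ s > 0, ∀ l : EuclideanSpace ℝ (Fin n),
      ∫ y, Complex.exp (Complex.I * ((⟪y, l⟫ : ℝ) : ℂ)) * ↑(G s y)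
        = ↑(Real.exp (-(μ * s * ‖l‖ ^ α * (1 + ‖l‖ ^ 2) ^ (γ / 2)))))
    (sE : ℝ → ℝ → EuclideanSpace ℝ (Fin n) → Ω → ℝ)
    (hsE : ∀ ε t x ω, sE ε t x ω =
      (ε ^ ((m : ℝ) * κ * χ) * L (ε ^ (-χ)) ^ m) ^ (-(1 / 2) : ℝ) *
        ((∫ y, G (ε * t) y *
            h (ζ ((ε ^ (-(1 / (α + γ)) - χ)) •
              ((ε ^ (1 / (α + γ))) • x - y)) ω)) - C 0))
    (t t' : ℝ) (ht : 0 < t) (ht' : 0 < t')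
    (x x' : EuclideanSpace ℝ (Fin n)) :
    Tendsto (fun ε : ℝ =>
        (↑((∫ ω, sE ε t x ω * sE ε t' x' ω ∂P)
          - (∫ ω, sE ε t x ω ∂P) * (∫ ω, sE ε t' x' ω ∂P)) : ℂ))
      (𝓝[>] 0)
      (𝓝 ((↑(C m ^ 2 * tauberK n ((m : ℝ) * κ)) : ℂ) *
        ∫ τ : EuclideanSpace ℝ (Fin n),
          Complex.exp (Complex.I * ((⟪x - x', τ⟫ : ℝ) : ℂ)) *
            ↑(Real.exp (-(μ * (t + t') * ‖τ‖ ^ (α + γ))) *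
              ‖τ‖ ^ ((m : ℝ) * κ - (n : ℝ))))) := by
  have hpair := isStdGaussianPair_of_field hζmeas hζGauss hζvar hζcov
  have hh : MemLp h 2 (gaussianReal 0 1) :=
    (memLp_two_iff_integrable_sq hhmeas.aestronglyMeasurable).2 hhL2
  have hR0 : R 0 = 1 := by
    rw [← sub_self (0 : EuclideanSpace ℝ (Fin n)), ← hζcov, ← hζvar 0]
    simp_rw [sq]
  have hR1 : ∀ z, |R z| ≤ 1 := fun z => by
    simpa using (hpair z 0).abs_corr_le_one
  have hc : Summable fun σ => if σ = 0 then 0 else C σ ^ 2 := by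
    have := (hasSum_tail ((hpair 0 0).hasSum_mehler hh hC)).summable
    simpa [hR0] using this
  have hm0 : m ≠ 0 := by omega
  obtain ⟨p, hp, hpc⟩ := exists_spectralMeasure hfmeas hfnonneg hfint hRf hR0
  have hApos : ∀ ε : ℝ, 0 < ε → 0 < ε ^ ((m : ℝ) * κ * χ) * L (ε ^ (-χ)) ^ m := fun ε hε =>
    mul_pos (Real.rpow_pos_of_pos hε _) (pow_pos (hLpos _ (Real.rpow_pos_of_pos hε _)) _)
  refine tendsto_of_seq_tendsto fun u hu => ?_
  obtain ⟨hu0, hupos⟩ := tendsto_nhdsWithin_iff.1 hu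
  obtain ⟨N, hN⟩ := eventually_atTop.1 hupos
  have hpos : ∀ k, 0 < u (k + N) := fun k => hN _ (Nat.le_add_left _ _)
  obtain ⟨ν, hνf, hνc, hlim⟩ := tendsto_covariance_of_seq hn hμ hα hγ hχ hR1 hpc
    (c := fun σ => if σ = 0 then 0 else C σ ^ 2) (fun σ => by split_ifs <;> positivity) hc
    (fun σ hσ => by
      rcases Nat.eq_zero_or_pos σ with h0 | h0
      · simp [h0]
      · simp [hCσ σ h0 hσ])
    (by simp only [hm0, if_false]; positivity) hm1 hκ0 hκn hLpos hL hRasymp (add_pos ht ht') (x - x')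
    hpos ((tendsto_add_atTop_iff_nat N).2 hu0)
  rw [← tendsto_add_atTop_iff_nat N]
  simp only [hm0, if_false] at hlim
  refine hlim.congr fun k => ?_
  have hs := mul_pos (hpos k) ht
  have hs' := mul_pos (hpos k) ht'
  exact (covariance_eq_integral_spectral hζmeas hpair hhmeas hh hC (hpos k) hα hγ
    (hApos _ (hpos k)) (hGint _ hs) (hGint _ hs') (hGft _ hs) (hGft _ hs') x x'
    (hsE (u (k + N)) t x) (hsE (u (k + N)) t' x') (hνc k)).symm
end
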